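/- arXiv:1001.4674 — 2 statements merged into one kernel-verified Lean document; each statement's English description precedes it below -/
import Mathlib

section
/- Russo–Seymour–Welsh theorem for critical bond percolation on ℤ² (Theorem 5.3): There is a constant c > 0 such that for every integer n ≥ 1, the rectangle [0,n] × [0,100n] has an open vertical crossing with probability at least c, i.e. Pr(V([0,n]×[0,100n])) ≥ c. -/
open MeasureTheory

/-- A bond of the grid `ℤ²`: `(v, true)` is the bond joining `v` to `v + (1,0)`,
and `(v, false)` is the bond joining `v` to `v + (0,1)`. -/
abbrev GridBond : Type := (ℤ × ℤ) × Bool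

/-- A percolation configuration: each bond is open (`true`) or closed (`false`). -/
abbrev PercCfg : Type := GridBond → Bool

/-- The vertices `u` and `v` are adjacent in `ℤ²` and the bond joining them is
open in the configuration `ω`. -/
def BondOpen (ω : PercCfg) (u v : ℤ × ℤ) : Prop :=
  (v = (u.1 + 1, u.2) ∧ ω (u, true) = true) ∨
  (u = (v.1 + 1, v.2) ∧ ω (v, true) = true) ∨
  (v = (u.1, u.2 + 1) ∧ ω (u, false) = true) ∨
  (u = (v.1, v.2 + 1) ∧ ω (v, false) = true)

/-- `v` lies in the rectangle `[a,b] × [c,d]` of `ℤ²`. -/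
def InRect (a b c d : ℤ) (v : ℤ × ℤ) : Prop :=
  a ≤ v.1 ∧ v.1 ≤ b ∧ c ≤ v.2 ∧ v.2 ≤ d

/-- `Pth 0, Pth 1, …, Pth k` is an open lattice path in the rectangle
`[a,b] × [c,d]`. -/
def OpenPathIn (ω : PercCfg) (a b c d : ℤ) (k : ℕ) (Pth : ℕ → ℤ × ℤ) : Prop :=
  (∀ i ≤ k, InRect a b c d (Pth i)) ∧ ∀ i < k, BondOpen ω (Pth i) (Pth (i + 1))

/-- The event that `[a,b] × [c,d]` has an open horizontal crossing. -/
def HCross (a b c d : ℤ) : Set PercCfg :=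
  {ω | ∃ k Pth, OpenPathIn ω a b c d k Pth ∧ (Pth 0).1 = a ∧ (Pth k).1 = b}

/-- The event that `[a,b] × [c,d]` has an open vertical crossing. -/
def VCross (a b c d : ℤ) : Set PercCfg :=
  {ω | ∃ k Pth, OpenPathIn ω a b c d k Pth ∧ (Pth 0).2 = c ∧ (Pth k).2 = d}

/-- `Pr` is the i.i.d. Bernoulli(1/2) bond percolation measure on `ℤ²`: a
probability measure under which the states of the bonds are independent, each
open with probability `1/2`. -/
def IsBondPerc (Pr : Measure PercCfg) : Prop :=
  IsProbabilityMeasure Pr ∧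
    ∀ (s : Finset GridBond) (f : GridBond → Bool),
      Pr {ω | ∀ e ∈ s, ω e = f e} = (1 / 2 : ENNReal) ^ s.card

/-! ### Open paths -/

/-- `u` and `v` are joined by an open bond whose endpoints lie in `D`. -/
def OpenStep (ω : PercCfg) (D : Set (ℤ × ℤ)) (u v : ℤ × ℤ) : Prop :=
  u ∈ D ∧ v ∈ D ∧ BondOpen ω u v

/-- `u` and `v` are joined by an open path in `D`. -/
abbrev OpenConn (ω : PercCfg) (D : Set (ℤ × ℤ)) : ℤ × ℤ → ℤ × ℤ → Prop :=
  Relation.ReflTransGen (OpenStep ω D)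

/-- The rectangle `[a,b] × [c,d]` as a set of vertices. -/
def rect (a b c d : ℤ) : Set (ℤ × ℤ) := {v | InRect a b c d v}

@[simp] lemma mem_rect {a b c d x y : ℤ} :
    (x, y) ∈ rect a b c d ↔ a ≤ x ∧ x ≤ b ∧ c ≤ y ∧ y ≤ d := Iff.rfl

lemma BondOpen.symm {ω : PercCfg} {u v : ℤ × ℤ} (h : BondOpen ω u v) : BondOpen ω v u := by
  unfold BondOpen at *; tauto

lemma OpenStep.symm {ω : PercCfg} {D : Set (ℤ × ℤ)} {u v : ℤ × ℤ} (h : OpenStep ω D u v) :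
    OpenStep ω D v u := ⟨h.2.1, h.1, h.2.2.symm⟩

lemma OpenConn.symm {ω : PercCfg} {D : Set (ℤ × ℤ)} {u v : ℤ × ℤ} (h : OpenConn ω D u v) :
    OpenConn ω D v u := by
  induction h with
  | refl => exact .refl
  | tail _ h ih => exact .head h.symm ih

lemma bondOpen_right {ω : PercCfg} {x y : ℤ} (h : ω ((x, y), true) = true) :
    BondOpen ω (x, y) (x + 1, y) := Or.inl ⟨rfl, h⟩

lemma bondOpen_up {ω : PercCfg} {x y : ℤ} (h : ω ((x, y), false) = true) :
    BondOpen ω (x, y) (x, y + 1) := Or.inr (Or.inr (Or.inl ⟨rfl, h⟩))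

/-- Four cases of an open bond, in coordinates. -/
lemma BondOpen.elim {ω : PercCfg} {P : ℤ × ℤ → ℤ × ℤ → Prop} {u v : ℤ × ℤ}
    (h : BondOpen ω u v)
    (hr : ∀ x y, ω ((x, y), true) = true → P (x, y) (x + 1, y))
    (hl : ∀ x y, ω ((x, y), true) = true → P (x + 1, y) (x, y))
    (hu : ∀ x y, ω ((x, y), false) = true → P (x, y) (x, y + 1))
    (hd : ∀ x y, ω ((x, y), false) = true → P (x, y + 1) (x, y)) : P u v := by
  obtain ⟨x, y⟩ := u
  obtain ⟨x', y'⟩ := v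
  rcases h with ⟨h, h'⟩ | ⟨h, h'⟩ | ⟨h, h'⟩ | ⟨h, h'⟩ <;> rw [h]
  · exact hr _ _ h'
  · exact hl _ _ h'
  · exact hu _ _ h'
  · exact hd _ _ h'

lemma BondOpen.mono {ω ω' : PercCfg} {u v : ℤ × ℤ} (h : BondOpen ω u v)
    (hω : ∀ e, ω e = true → ω' e = true) : BondOpen ω' u v := by
  have h1 := hω (u, true)
  have h2 := hω (v, true)
  have h3 := hω (u, false)
  have h4 := hω (v, false)
  unfold BondOpen at *
  tauto

lemma OpenConn.mono {ω ω' : PercCfg} {D D' : Set (ℤ × ℤ)} {u v : ℤ × ℤ} (h : OpenConn ω D u v)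
    (hω : ∀ e, ω e = true → ω' e = true) (hD : D ⊆ D') : OpenConn ω' D' u v := by
  induction h with
  | refl => exact .refl
  | tail _ h ih => exact ih.tail ⟨hD h.1, hD h.2.1, h.2.2.mono hω⟩

lemma OpenConn.mem {ω : PercCfg} {D : Set (ℤ × ℤ)} {u v : ℤ × ℤ} (h : OpenConn ω D u v)
    (hu : u ∈ D) : v ∈ D := by
  induction h with
  | refl => exact hu
  | tail _ h _ => exact h.2.1

lemma exists_openPathIn_iff {ω : PercCfg} {a b c d : ℤ} {u v : ℤ × ℤ} :
    (∃ k Pth, OpenPathIn ω a b c d k Pth ∧ Pth 0 = u ∧ Pth k = v) ↔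
      u ∈ rect a b c d ∧ OpenConn ω (rect a b c d) u v := by
  constructor
  · rintro ⟨k, Pth, ⟨hR, hB⟩, rfl, rfl⟩
    refine ⟨hR 0 (Nat.zero_le _), ?_⟩
    have : ∀ j ≤ k, OpenConn ω (rect a b c d) (Pth 0) (Pth j) := by
      intro j hj
      induction j with
      | zero => exact .refl
      | succ j ih => exact (ih (by omega)).tail ⟨hR _ (by omega), hR _ hj, hB j (by omega)⟩
    exact this k le_rfl
  · rintro ⟨hu, h⟩
    induction h with
    | refl => exact ⟨0, fun _ => u, ⟨fun _ _ => hu, by simp⟩, rfl, rfl⟩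
    | @tail v w _ hs ih =>
      obtain ⟨k, Pth, ⟨hR, hB⟩, h0, hk⟩ := ih
      refine ⟨k + 1, fun i => if i ≤ k then Pth i else w, ⟨?_, ?_⟩, by simp [h0], by simp⟩
      · intro i _
        by_cases hi : i ≤ k
        · simpa [hi] using hR i hi
        · simpa [hi] using show InRect a b c d w from hs.2.1
      · intro i hi
        rcases Nat.lt_succ_iff_lt_or_eq.1 hi with hi | rfl
        · simpa [hi.le, Nat.succ_le_of_lt hi] using hB i hi
        · simpa [hk] using hs.2.2

lemma mem_HCross_iff {ω : PercCfg} {a b c d : ℤ} :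
    ω ∈ HCross a b c d ↔
      ∃ u v, u ∈ rect a b c d ∧ u.1 = a ∧ v.1 = b ∧ OpenConn ω (rect a b c d) u v := by
  constructor
  · rintro ⟨k, Pth, h, h0, hk⟩
    obtain ⟨hu, hc⟩ := exists_openPathIn_iff.1 ⟨k, Pth, h, rfl, rfl⟩
    exact ⟨_, _, hu, h0, hk, hc⟩
  · rintro ⟨u, v, hu, hua, hvb, hc⟩
    obtain ⟨k, Pth, h, rfl, rfl⟩ := exists_openPathIn_iff.2 ⟨hu, hc⟩
    exact ⟨k, Pth, h, hua, hvb⟩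

lemma mem_VCross_iff {ω : PercCfg} {a b c d : ℤ} :
    ω ∈ VCross a b c d ↔
      ∃ u v, u ∈ rect a b c d ∧ u.2 = c ∧ v.2 = d ∧ OpenConn ω (rect a b c d) u v := by
  constructor
  · rintro ⟨k, Pth, h, h0, hk⟩
    obtain ⟨hu, hc⟩ := exists_openPathIn_iff.1 ⟨k, Pth, h, rfl, rfl⟩
    exact ⟨_, _, hu, h0, hk, hc⟩
  · rintro ⟨u, v, hu, hua, hvb, hc⟩
    obtain ⟨k, Pth, h, rfl, rfl⟩ := exists_openPathIn_iff.2 ⟨hu, hc⟩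
    exact ⟨k, Pth, h, hua, hvb⟩

/-- A walk from `J` to its complement leaves `J` for the last time through some step. -/
lemma exists_last_exit {α : Type*} {r : α → α → Prop} {J : Set α} {p q : α}
    (h : Relation.ReflTransGen r p q) (hp : p ∈ J) (hq : q ∉ J) :
    ∃ v w, v ∈ J ∧ w ∉ J ∧ r v w ∧
      Relation.ReflTransGen (fun a b => a ∉ J ∧ b ∉ J ∧ r a b) w q := by
  induction h with
  | refl => exact absurd hp hq
  | @tail b c _ hbc ih =>
    by_cases hb : b ∈ J
    · exact ⟨b, c, hb, hq, hbc, .refl⟩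
    · obtain ⟨v, w, hv, hw, hvw, hc⟩ := ih hb
      exact ⟨v, w, hv, hw, hvw, hc.tail ⟨hb, hq, hbc⟩⟩

/-- The configuration on the dual lattice: `(x, y)` stands for the unit square centred at
`(x - 1/2, y + 1/2)`, and a dual bond is open when the bond it crosses is closed. -/
def dualCfg (ω : PercCfg) : PercCfg
  | ((x, y), true) => !ω ((x, y), false)
  | ((x, y), false) => !ω ((x - 1, y + 1), true)

@[simp] lemma dualCfg_right (ω : PercCfg) (x y : ℤ) :
    dualCfg ω ((x, y), true) = !ω ((x, y), false) := rfl

@[simp] lemma dualCfg_up (ω : PercCfg) (x y : ℤ) :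
    dualCfg ω ((x, y), false) = !ω ((x - 1, y + 1), true) := rfl

/-- A function on the squares right of the line `x = 0` with prescribed jumps mod 2: `e x y` is the
jump across the vertical bond at `(x, y)`, `g x y` the jump across the horizontal one. -/
lemma exists_potential (e g : ℤ → ℤ → ZMod 2) {h : ℤ} (hg : ∀ y, g (-1) y = 0)
    (hc : ∀ x y, 0 ≤ x → 0 < y → y < h → e x y + e x (y - 1) + g x y + g (x - 1) y = 0) :
    ∃ w : ℤ → ℤ → ZMod 2, (∀ y, w 0 y = 0) ∧ (∀ x y, 0 ≤ x → w (x + 1) y = w x y + e x y) ∧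
      ∀ x y, 0 ≤ x → 0 ≤ y → y + 1 < h → w x (y + 1) = w x y + g (x - 1) (y + 1) := by
  refine ⟨fun x y => ∑ i ∈ Finset.range x.toNat, e i y, by simp, ?_, ?_⟩
  · intro x y hx
    obtain ⟨k, rfl⟩ := Int.eq_ofNat_of_zero_le hx
    have : ((k : ℤ) + 1).toNat = k + 1 := by omega
    simp [this, Finset.sum_range_succ]
  · intro x y hx hy hyh
    obtain ⟨k, rfl⟩ := Int.eq_ofNat_of_zero_le hx
    simp only [Int.toNat_natCast]
    induction k with
    | zero => simp [hg]
    | succ k ih =>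
      rw [Finset.sum_range_succ, Finset.sum_range_succ, ih (by positivity)]
      have := hc k (y + 1) (by positivity) (by omega) hyh
      simp only [add_sub_cancel_right] at this
      push_cast
      simp only [add_sub_cancel_right]
      have h2 : ∀ t : ZMod 2, t + t = 0 := by decide
      linear_combination this - h2 (e k y) - h2 (g k (y + 1))

/-- `e` (vertical bonds) and `g` (horizontal bonds) form a chain mod 2 with boundary `u + v`,
supported on open bonds with endpoints in `D`. -/
structure IsOpenChain (ω : PercCfg) (D : Set (ℤ × ℤ)) (u v : ℤ × ℤ) (e g : ℤ → ℤ → ZMod 2) :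
    Prop where
  vert : ∀ x y, e x y ≠ 0 → ω ((x, y), false) = true ∧ (x, y) ∈ D ∧ (x, y + 1) ∈ D
  horiz : ∀ x y, g x y ≠ 0 → ω ((x, y), true) = true ∧ (x, y) ∈ D ∧ (x + 1, y) ∈ D
  boundary : ∀ x y, e x y + e x (y - 1) + g x y + g (x - 1) y =
    (if u = (x, y) then 1 else 0) + if v = (x, y) then 1 else 0

lemma IsOpenChain.symm {ω : PercCfg} {D : Set (ℤ × ℤ)} {u v : ℤ × ℤ} {e g : ℤ → ℤ → ZMod 2}
    (h : IsOpenChain ω D u v e g) : IsOpenChain ω D v u e g :=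
  ⟨h.vert, h.horiz, fun x y => by rw [h.boundary, add_comm]⟩

lemma OpenStep.exists_chain {ω : PercCfg} {D : Set (ℤ × ℤ)} {u v : ℤ × ℤ}
    (h : OpenStep ω D u v) : ∃ e g, IsOpenChain ω D u v e g := by
  have hor : ∀ x₀ y₀ : ℤ, ω ((x₀, y₀), true) = true → (x₀, y₀) ∈ D → (x₀ + 1, y₀) ∈ D →
      ∃ e g, IsOpenChain ω D (x₀, y₀) (x₀ + 1, y₀) e g := by
    intro x₀ y₀ hω h1 h2
    refine ⟨fun _ _ => 0, fun x y => if (x₀, y₀) = (x, y) then 1 else 0, by simp, ?_, ?_⟩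
    · intro x y hxy
      simp only [Prod.mk.injEq, ne_eq, ite_eq_right_iff, one_ne_zero, imp_false,
        not_not] at hxy
      obtain ⟨rfl, rfl⟩ := hxy
      exact ⟨hω, h1, h2⟩
    · intro x y
      simp [eq_sub_iff_add_eq]
  have ver : ∀ x₀ y₀ : ℤ, ω ((x₀, y₀), false) = true → (x₀, y₀) ∈ D → (x₀, y₀ + 1) ∈ D →
      ∃ e g, IsOpenChain ω D (x₀, y₀) (x₀, y₀ + 1) e g := by
    intro x₀ y₀ hω h1 h2
    refine ⟨fun x y => if (x₀, y₀) = (x, y) then 1 else 0, fun _ _ => 0, ?_, by simp, ?_⟩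
    · intro x y hxy
      simp only [Prod.mk.injEq, ne_eq, ite_eq_right_iff, one_ne_zero, imp_false,
        not_not] at hxy
      obtain ⟨rfl, rfl⟩ := hxy
      exact ⟨hω, h1, h2⟩
    · intro x y
      simp [eq_sub_iff_add_eq]
  obtain ⟨hu, hv, huv⟩ := h
  revert hu hv
  refine huv.elim (P := fun a b => a ∈ D → b ∈ D → ∃ e g, IsOpenChain ω D a b e g)
    hor ?_ ver ?_
  · intro x y hω h1 h2
    obtain ⟨e, g, h⟩ := hor x y hω h2 h1
    exact ⟨e, g, h.symm⟩
  · intro x y hω h1 h2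
    obtain ⟨e, g, h⟩ := ver x y hω h2 h1
    exact ⟨e, g, h.symm⟩

lemma OpenConn.exists_chain {ω : PercCfg} {D : Set (ℤ × ℤ)} {u v : ℤ × ℤ}
    (h : OpenConn ω D u v) : ∃ e g, IsOpenChain ω D u v e g := by
  induction h with
  | refl =>
    refine ⟨fun _ _ => 0, fun _ _ => 0, by simp, by simp, fun x y => ?_⟩
    simp only [add_zero]
    split_ifs <;> decide
  | @tail a b _ hab ih =>
    obtain ⟨e, g, he, hg, hb⟩ := ih
    obtain ⟨e', g', he', hg', hb'⟩ := hab.exists_chain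
    refine ⟨fun x y => e x y + e' x y, fun x y => g x y + g' x y, ?_, ?_, ?_⟩
    · intro x y hxy
      by_cases h0 : e x y = 0
      · exact he' x y (by simpa [h0] using hxy)
      · exact he x y h0
    · intro x y hxy
      by_cases h0 : g x y = 0
      · exact hg' x y (by simpa [h0] using hxy)
      · exact hg x y h0
    · intro x y
      have h1 := hb x y
      have h2 := hb' x y
      have h3 : ∀ t : ZMod 2, t + t = 0 := by decide
      linear_combination h1 + h2 + h3 (if a = (x, y) then 1 else 0)

/-- The two sides of a bottom-to-top path of `[0,b] × [0,h]` are labelled `0` and `1`. -/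
lemma OpenConn.exists_sides {ω : PercCfg} {D : Set (ℤ × ℤ)} {b h : ℤ} {u v : ℤ × ℤ} (hb : 0 ≤ b)
    (hh : 0 < h) (hD : D ⊆ rect 0 b 0 h) (hu : u ∈ D) (hu0 : u.2 = 0) (hvh : v.2 = h)
    (huv : OpenConn ω D u v) :
    ∃ w : ℤ → ℤ → ZMod 2, (∀ y, w 0 y = 0) ∧ (∀ y, 0 ≤ y → y < h → w (b + 1) y = 1) ∧
      (∀ x y, 0 ≤ x → w (x + 1) y ≠ w x y →
        ω ((x, y), false) = true ∧ (x, y) ∈ D ∧ (x, y + 1) ∈ D) ∧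
      ∀ x y, 0 ≤ x → 0 ≤ y → y + 1 < h → w x (y + 1) ≠ w x y →
        ω ((x - 1, y + 1), true) = true ∧ (x - 1, y + 1) ∈ D ∧ (x, y + 1) ∈ D := by
  obtain ⟨e, g, he, hg, hbd⟩ := huv.exists_chain
  obtain ⟨u1, u2⟩ := u
  obtain ⟨v1, v2⟩ := v
  simp only at hu0 hvh
  subst hu0 hvh
  have hg0 : ∀ y, g (-1) y = 0 := by
    intro y
    by_contra h0
    have := hD (hg _ _ h0).2.1
    simp at this
  have hgb : ∀ y, g b y = 0 := by
    intro y
    by_contra h0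
    have := hD (hg _ _ h0).2.2
    simp at this
  have he0 : ∀ x, e x (-1) = 0 := by
    intro x
    by_contra h0
    have := hD (he _ _ h0).2.1
    simp at this
  obtain ⟨w, hw0, hwe, hwg⟩ := exists_potential e g (h := v2) hg0 (by
    intro x y hx hy hyh
    rw [hbd, if_neg, if_neg]
    · simp
    · simp only [Prod.mk.injEq]; omega
    · simp only [Prod.mk.injEq]; omega)
  have hbot : ∀ k : ℕ, w k 0 = g (k - 1) 0 + if u1 < k ∧ 0 ≤ u1 then 1 else 0 := by
    intro k
    induction k with
    | zero =>
      rw [if_neg (by push_cast; omega)]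
      simp [hw0, hg0]
    | succ k ih =>
      have h1 := hbd k 0
      push_cast
      rw [hwe k 0 (by positivity), ih]
      simp only [zero_sub, he0, Prod.mk.injEq, and_true, hh.ne', and_false, if_false,
        add_zero] at h1
      have h2 : ((if u1 < (k : ℤ) + 1 ∧ 0 ≤ u1 then 1 else 0) : ZMod 2) =
          (if u1 < k ∧ 0 ≤ u1 then 1 else 0) + if u1 = k then 1 else 0 := by
        by_cases h3 : u1 = k
        · simp [h3]
        · have : u1 < (k : ℤ) + 1 ↔ u1 < k := by omega
          simp [h3, this]
      have h3 : ∀ t : ZMod 2, t + t = 0 := by decide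
      rw [h2, add_sub_cancel_right, ← h1]
      linear_combination -h3 (g k 0)
  have hu' := hD hu
  rw [mem_rect] at hu'
  refine ⟨w, hw0, ?_, ?_, ?_⟩
  · intro y hy
    obtain ⟨k, rfl⟩ := Int.eq_ofNat_of_zero_le hy
    induction k with
    | zero =>
      intro _
      have := hbot (b + 1).toNat
      rw [Int.toNat_of_nonneg (by omega), if_pos (by omega)] at this
      simpa [hgb] using this
    | succ k ih =>
      intro hk
      push_cast at hk ⊢
      rw [hwg _ _ (by omega) (by positivity) hk, ih (by positivity) (by omega),
        add_sub_cancel_right, hgb, add_zero]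
  · intro x y hx hne
    rw [hwe x y hx] at hne
    exact he x y (by simpa using hne)
  · intro x y hx hy hyh hne
    rw [hwg x y hx hy hyh] at hne
    have := hg (x - 1) (y + 1) (by simpa using hne)
    rwa [sub_add_cancel] at this

/-- A top-to-bottom open path and a left-to-right dual open path exclude each other. -/
lemma not_HCross_dualCfg {ω : PercCfg} {b h : ℤ} (hb : 0 ≤ b) (hh : 0 < h)
    (hV : ω ∈ VCross 0 b 0 h) : dualCfg ω ∉ HCross 0 (b + 1) 0 (h - 1) := by
  intro hH
  obtain ⟨u, v, hu, hu0, hvh, huv⟩ := mem_VCross_iff.1 hV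
  obtain ⟨p, q, hp, hp0, hqb, hpq⟩ := mem_HCross_iff.1 hH
  obtain ⟨w, hw0, hw1, hwe, hwg⟩ := huv.exists_sides hb hh subset_rfl hu hu0 hvh
  have hz : ∀ q, OpenConn (dualCfg ω) (rect 0 (b + 1) 0 (h - 1)) p q → w q.1 q.2 = 0 := by
    intro q hq
    induction hq with
    | refl => rw [hp0, hw0]
    | tail _ hs ih =>
      rw [← ih]
      obtain ⟨h1, h2, h3⟩ := hs
      revert h1 h2
      refine h3.elim (P := fun u v => u ∈ rect 0 (b + 1) 0 (h - 1) →
        v ∈ rect 0 (b + 1) 0 (h - 1) → w v.1 v.2 = w u.1 u.2) ?_ ?_ ?_ ?_ <;>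
      · intro x y hω h1 h2
        simp only [mem_rect] at h1 h2
        by_contra hne
        simp only [dualCfg_right, dualCfg_up, Bool.not_eq_true'] at hω
        first
        | simpa [hω] using (hwe x y (by omega) hne).1
        | simpa [hω] using (hwe x y (by omega) (Ne.symm hne)).1
        | simpa [hω] using (hwg x y (by omega) (by omega) (by omega) hne).1
        | simpa [hω] using (hwg x y (by omega) (by omega) (by omega) (Ne.symm hne)).1
  have hq := OpenConn.mem hpq hp
  have h0 := hz q hpq
  obtain ⟨q1, q2⟩ := q
  simp only [mem_rect] at hq hqb
  rw [hqb, hw1 _ (by omega) (by omega)] at h0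
  exact one_ne_zero h0

/-- Left-to-right and top-to-bottom open paths in a rectangle meet. -/
lemma OpenConn.meet {ω : PercCfg} {b h : ℤ} {p q u v : ℤ × ℤ} (hh : 0 ≤ h)
    (hp : p ∈ rect 0 b 0 h) (hu : u ∈ rect 0 b 0 h)
    (hp0 : p.1 = 0) (hqb : q.1 = b) (hu0 : u.2 = 0) (hvh : v.2 = h)
    (hpq : OpenConn ω (rect 0 b 0 h) p q) (huv : OpenConn ω (rect 0 b 0 h) u v) :
    OpenConn ω (rect 0 b 0 h) u p := by
  by_contra hup
  set C : Set (ℤ × ℤ) := {z | OpenConn ω (rect 0 b 0 h) u z} with hC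
  have hCR : C ⊆ rect 0 b 0 h := fun z hz => OpenConn.mem hz hu
  have hv := hCR huv
  obtain ⟨v1, v2⟩ := v
  simp only at hvh
  subst hvh
  set D : Set (ℤ × ℤ) := insert (v1, v2 + 1) C with hD
  have hb : 0 ≤ b := by
    obtain ⟨u1, u2⟩ := u
    simp only [mem_rect] at hu
    omega
  have hCD : ∀ z, OpenConn ω (rect 0 b 0 v2) u z → OpenConn (fun _ => true) D u z := by
    intro z hz
    induction hz with
    | refl => exact .refl
    | @tail y z hy hs ih =>
      exact ih.tail ⟨Or.inr hy, Or.inr (hy.tail hs), hs.2.2.mono fun _ _ => rfl⟩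
  have huv' : OpenConn (fun _ => true) D u (v1, v2 + 1) :=
    (hCD _ huv).tail ⟨Or.inr huv, Or.inl rfl, bondOpen_up rfl⟩
  have hDR : D ⊆ rect 0 b 0 (v2 + 1) := by
    rintro ⟨x, y⟩ (hz | hz)
    · rw [mem_rect] at hv
      rw [hz, mem_rect]
      omega
    · have := hCR hz
      simp only [mem_rect] at this ⊢
      omega
  obtain ⟨w, hw0, hw1, hwe, hwg⟩ := huv'.exists_sides hb (by omega) hDR (Or.inr .refl) hu0 rfl
  have hz : ∀ z, OpenConn ω (rect 0 b 0 v2) p z → z ∉ D ∧ w z.1 z.2 = 0 := by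
    intro z hz
    have hzD : ∀ z, OpenConn ω (rect 0 b 0 v2) p z → z ∉ D := by
      rintro z hz (h1 | h1)
      · have := OpenConn.mem hz hp
        rw [h1, mem_rect] at this
        omega
      · exact hup (Relation.ReflTransGen.trans h1 (OpenConn.symm hz))
    refine ⟨hzD z hz, ?_⟩
    induction hz with
    | refl => rw [hp0, hw0]
    | tail hy hs ih =>
      have hy1 := hzD _ hy
      have hy2 := hzD _ (hy.tail hs)
      rw [← ih]
      obtain ⟨h1, h2, h3⟩ := hs
      clear hy ih
      revert h1 h2 hy1 hy2
      refine h3.elim (P := fun u v => u ∉ D → v ∉ D → u ∈ rect 0 b 0 v2 →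
        v ∈ rect 0 b 0 v2 → w v.1 v.2 = w u.1 u.2) ?_ ?_ ?_ ?_ <;>
      · intro x y _ hy1 hy2 h1 h2
        simp only [mem_rect] at h1 h2
        by_contra hne
        first
        | exact hy1 (hwe x y (by omega) hne).2.1
        | exact hy2 (hwe x y (by omega) (Ne.symm hne)).2.1
        | exact hy2 (hwg x y (by omega) (by omega) (by omega) hne).2.2
        | exact hy1 (hwg x y (by omega) (by omega) (by omega) (Ne.symm hne)).2.2
  obtain ⟨hqD, hq0⟩ := hz q hpq
  have hq := OpenConn.mem hpq hp
  obtain ⟨q1, q2⟩ := q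
  simp only [mem_rect] at hq hqb hq0
  subst hqb
  refine hqD (hwe q1 q2 hb ?_).2.1
  rw [hw1 _ (by omega) (by omega), hq0]
  exact one_ne_zero

/-- The squares joined to the left side of `[0,b] × [0,h]` by a dual open path. -/
def leftCluster (ω : PercCfg) (b h : ℤ) : Set (ℤ × ℤ) :=
  {f | ∃ l ∈ rect 0 (b + 1) 0 (h - 1), l.1 = 0 ∧
    OpenConn (dualCfg ω) (rect 0 (b + 1) 0 (h - 1)) l f}

/-- The squares joined to the right side of `[0,b] × [0,h]` by a lattice path avoiding `F`. -/
def rightComponent (b h : ℤ) (F : Set (ℤ × ℤ)) : Set (ℤ × ℤ) :=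
  {f | ∃ r ∈ rect 0 (b + 1) 0 (h - 1) \ F, r.1 = b + 1 ∧
    OpenConn (fun _ => true) (rect 0 (b + 1) 0 (h - 1) \ F) r f}

lemma leftCluster_subset (ω : PercCfg) (b h : ℤ) :
    leftCluster ω b h ⊆ rect 0 (b + 1) 0 (h - 1) := by
  rintro f ⟨l, hl, -, hc⟩
  exact OpenConn.mem hc hl

lemma rightComponent_subset (b h : ℤ) (F : Set (ℤ × ℤ)) :
    rightComponent b h F ⊆ rect 0 (b + 1) 0 (h - 1) \ F := by
  rintro f ⟨r, hr, -, hc⟩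
  exact OpenConn.mem hc hr

lemma mem_leftCluster_of_bondOpen {ω : PercCfg} {b h : ℤ} {f f' : ℤ × ℤ}
    (hf : f ∈ leftCluster ω b h) (hf' : f' ∈ rect 0 (b + 1) 0 (h - 1))
    (hs : BondOpen (dualCfg ω) f f') : f' ∈ leftCluster ω b h := by
  have hfR := leftCluster_subset _ _ _ hf
  obtain ⟨l, hl, hl0, hc⟩ := hf
  exact ⟨l, hl, hl0, hc.tail ⟨hfR, hf', hs⟩⟩

lemma mem_rightComponent_of_bondOpen {b h : ℤ} {F : Set (ℤ × ℤ)} {f f' : ℤ × ℤ}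
    (hf : f ∈ rightComponent b h F) (hf' : f' ∈ rect 0 (b + 1) 0 (h - 1)) (hfF : f' ∉ F)
    (hs : BondOpen (fun _ => true) f f') : f' ∈ rightComponent b h F := by
  have hfR := rightComponent_subset _ _ _ hf
  obtain ⟨l, hl, hl0, hc⟩ := hf
  exact ⟨l, hl, hl0, hc.tail ⟨hfR, ⟨hf', hfF⟩, hs⟩⟩

lemma mem_HCross_dualCfg_iff {ω : PercCfg} {b h : ℤ} :
    dualCfg ω ∈ HCross 0 (b + 1) 0 (h - 1) ↔ ∃ f ∈ leftCluster ω b h, f.1 = b + 1 := by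
  rw [mem_HCross_iff]
  constructor
  · rintro ⟨u, v, hu, hu0, hvb, hc⟩
    exact ⟨v, ⟨u, hu, hu0, hc⟩, hvb⟩
  · rintro ⟨v, ⟨u, hu, hu0, hc⟩, hvb⟩
    exact ⟨u, v, hu, hu0, hvb, hc⟩

/-- The bond crossed when passing between two squares, one in the right component of the complement
of the left cluster and the other not, is open. -/
lemma not_bondOpen_dualCfg {ω : PercCfg} {b h : ℤ} {f f' : ℤ × ℤ}
    (hf : f ∈ rightComponent b h (leftCluster ω b h))
    (hf' : f' ∉ rightComponent b h (leftCluster ω b h))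
    (hR : f' ∈ rect 0 (b + 1) 0 (h - 1)) (hs : BondOpen (fun _ => true) f f') :
    ¬ BondOpen (dualCfg ω) f' f := by
  intro ho
  have hfR := rightComponent_subset _ _ _ hf
  refine hfR.2 (mem_leftCluster_of_bondOpen ?_ hfR.1 ho)
  by_contra hfF
  exact hf' (mem_rightComponent_of_bondOpen hf hR hfF hs)

section Interface

variable {ω : PercCfg} {b h : ℤ}

lemma open_of_separated_vert {x y : ℤ}
    (h1 : (x, y) ∈ rect 0 (b + 1) 0 (h - 1)) (h2 : (x + 1, y) ∈ rect 0 (b + 1) 0 (h - 1))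
    (hne : ¬((x, y) ∈ rightComponent b h (leftCluster ω b h) ↔
      (x + 1, y) ∈ rightComponent b h (leftCluster ω b h))) :
    OpenStep ω (rect 0 b 0 h) (x, y) (x, y + 1) := by
  simp only [mem_rect] at h1 h2
  refine ⟨by rw [mem_rect]; omega, by rw [mem_rect]; omega, bondOpen_up ?_⟩
  by_contra hω
  have hd : BondOpen (dualCfg ω) (x, y) (x + 1, y) := bondOpen_right (by simpa using hω)
  have hd' := hd.mono (ω' := fun _ => true) fun _ _ => rfl
  by_cases h3 : (x, y) ∈ rightComponent b h (leftCluster ω b h)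
  · exact not_bondOpen_dualCfg h3 (by tauto) h2 hd' hd.symm
  · exact not_bondOpen_dualCfg (by tauto) h3 h1 hd'.symm hd

lemma open_of_separated_horiz
    (hω : dualCfg ω ∉ HCross 0 (b + 1) 0 (h - 1)) {x y : ℤ}
    (h1 : (x, y - 1) ∈ rect 0 (b + 1) 0 (h - 1)) (h2 : (x, y) ∈ rect 0 (b + 1) 0 (h - 1))
    (hne : ¬((x, y - 1) ∈ rightComponent b h (leftCluster ω b h) ↔
      (x, y) ∈ rightComponent b h (leftCluster ω b h))) :
    OpenStep ω (rect 0 b 0 h) (x - 1, y) (x, y) := by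
  have hx0 : x ≠ 0 := by
    rintro rfl
    have : ∀ z, (0, z) ∈ rect 0 (b + 1) 0 (h - 1) →
        (0, z) ∉ rightComponent b h (leftCluster ω b h) := fun z hz hz' =>
      (rightComponent_subset _ _ _ hz').2 ⟨_, hz, rfl, .refl⟩
    exact hne (iff_of_false (this _ h1) (this _ h2))
  have hxb : x ≠ b + 1 := by
    rintro rfl
    have : ∀ z, (b + 1, z) ∈ rect 0 (b + 1) 0 (h - 1) →
        (b + 1, z) ∈ rightComponent b h (leftCluster ω b h) := fun z hz =>
      ⟨_, ⟨hz, fun hF => hω (mem_HCross_dualCfg_iff.2 ⟨_, hF, rfl⟩)⟩, rfl, .refl⟩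
    exact hne (iff_of_true (this _ h1) (this _ h2))
  have h1' := h1
  have h2' := h2
  simp only [mem_rect] at h1 h2
  have hB : BondOpen ω (x - 1, y) (x, y) := by
    by_contra hB
    have hd : BondOpen (dualCfg ω) (x, y - 1) (x, y) := by
      have h3 : ω ((x - 1, y), true) ≠ true := fun h3 => hB (by simpa using bondOpen_right h3)
      simpa using bondOpen_up (ω := dualCfg ω) (x := x) (y := y - 1) (by simpa using h3)
    have hd' := hd.mono (ω' := fun _ => true) fun _ _ => rfl
    by_cases h3 : (x, y - 1) ∈ rightComponent b h (leftCluster ω b h)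
    · exact not_bondOpen_dualCfg h3 (by tauto) h2' hd' hd.symm
    · exact not_bondOpen_dualCfg (by tauto) h3 h1' hd'.symm hd
  exact ⟨by rw [mem_rect]; omega, by rw [mem_rect]; omega, hB⟩

/-- `v` is an endpoint of a bond separating `G` from the other squares of `[0,b+1] × [0,h-1]`. -/
def OnInterface (b h : ℤ) (G : Set (ℤ × ℤ)) (v : ℤ × ℤ) : Prop :=
  (∃ x y, (x, y) ∈ rect 0 (b + 1) 0 (h - 1) ∧ (x + 1, y) ∈ rect 0 (b + 1) 0 (h - 1) ∧
    ¬((x, y) ∈ G ↔ (x + 1, y) ∈ G) ∧ (v = (x, y) ∨ v = (x, y + 1))) ∨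
  ∃ x y, (x, y - 1) ∈ rect 0 (b + 1) 0 (h - 1) ∧ (x, y) ∈ rect 0 (b + 1) 0 (h - 1) ∧
    ¬((x, y - 1) ∈ G ↔ (x, y) ∈ G) ∧ (v = (x - 1, y) ∨ v = (x, y))

lemma exists_separated_in_row (hb : 0 ≤ b)
    (hω : dualCfg ω ∉ HCross 0 (b + 1) 0 (h - 1)) {y : ℤ} (hy : 0 ≤ y) (hyh : y < h) :
    ∃ x, 0 ≤ x ∧ x ≤ b ∧ (x, y) ∉ rightComponent b h (leftCluster ω b h) ∧
      (x + 1, y) ∈ rightComponent b h (leftCluster ω b h) := by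
  by_contra! hcon
  have : ∀ k : ℕ, (k : ℤ) ≤ b + 1 → ((k : ℤ), y) ∉ rightComponent b h (leftCluster ω b h) := by
    intro k
    induction k with
    | zero =>
      intro _ h0
      refine (rightComponent_subset _ _ _ h0).2 ⟨_, ?_, rfl, .refl⟩
      simp only [mem_rect, Nat.cast_zero]
      omega
    | succ k ih =>
      intro hk
      push_cast at hk ⊢
      exact hcon k (by positivity) (by omega) (ih (by omega))
  have h1 := this (b + 1).toNat (by omega)
  rw [Int.toNat_of_nonneg (by omega)] at h1
  refine h1 ⟨(b + 1, y), ⟨by rw [mem_rect]; omega, fun hF => ?_⟩, rfl, .refl⟩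
  exact hω (mem_HCross_dualCfg_iff.2 ⟨_, hF, rfl⟩)

/-- The interface is connected and joins the top side to the bottom side. -/
lemma OnInterface.exists_conn (hb : 0 ≤ b) (hh : 0 < h)
    (hω : dualCfg ω ∉ HCross 0 (b + 1) 0 (h - 1)) {v : ℤ × ℤ}
    (hv : OnInterface b h (rightComponent b h (leftCluster ω b h)) v) :
    ∃ t t', t.2 = 0 ∧ t'.2 = h ∧ v ∈ rect 0 b 0 h ∧
      OpenConn ω (rect 0 b 0 h) v t ∧ OpenConn ω (rect 0 b 0 h) v t' := by
  classical
  set F := leftCluster ω b h with hF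
  set G := rightComponent b h F with hG
  set A : Set (ℤ × ℤ) := {z | v ∈ rect 0 b 0 h ∧ OpenConn ω (rect 0 b 0 h) v z} with hA
  have hAR : ∀ z ∈ A, z ∈ rect 0 b 0 h := fun z hz => OpenConn.mem hz.2 hz.1
  have hAs : ∀ z z', OpenStep ω (rect 0 b 0 h) z z' → (z ∈ A ↔ z' ∈ A) := fun z z' hs =>
    ⟨fun hz => ⟨hz.1, hz.2.tail hs⟩, fun hz => ⟨hz.1, hz.2.tail hs.symm⟩⟩
  set α : ℤ → ℤ → ZMod 2 := fun x y => if (x, y) ∈ A then 1 else 0 with hα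
  set β : ℤ → ℤ → ZMod 2 := fun x y => if (x, y) ∈ G then 1 else 0 with hβ
  have hβi : ∀ x y x' y', ((x, y) ∈ G ↔ (x', y') ∈ G) → β x y + β x' y' = 0 := by
    intro x y x' y' hi
    simp only [hβ, hi]
    split_ifs <;> decide
  have hα0 : ∀ x y, (x, y) ∉ rect 0 b 0 h → α x y = 0 := fun x y hxy =>
    if_neg fun hz => hxy (hAR _ hz)
  have hαe : ∀ x y, 0 ≤ x → x ≤ b → 0 ≤ y → y < h →
      α x y * (β x y + β (x + 1) y) = α x (y + 1) * (β x y + β (x + 1) y) := by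
    intro x y hx hxb hy hyh
    by_cases hi : (x, y) ∈ G ↔ (x + 1, y) ∈ G
    · rw [hβi _ _ _ _ hi, mul_zero, mul_zero]
    · have := hAs _ _ (open_of_separated_vert (by rw [mem_rect]; omega)
        (by rw [mem_rect]; omega) hi)
      simp only [hα, this]
  have hαg : ∀ x y, 0 ≤ x → 0 < y → y < h →
      α (x - 1) y * (β x (y - 1) + β x y) = α x y * (β x (y - 1) + β x y) := by
    intro x y hx hy hyh
    by_cases hi : (x, y - 1) ∈ G ↔ (x, y) ∈ G
    · rw [hβi _ _ _ _ hi, mul_zero, mul_zero]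
    · by_cases hxb : x ≤ b + 1
      · have := hAs _ _ (open_of_separated_horiz hω (by rw [mem_rect]; omega)
          (by rw [mem_rect]; omega) hi)
        simp only [hα, this]
      · rw [hα0, hα0] <;> rw [mem_rect] <;> omega
  obtain ⟨w, hw0, hwe, hwg⟩ := exists_potential (fun x y => α x y * (β x y + β (x + 1) y))
    (fun x y => α x y * (β (x + 1) (y - 1) + β (x + 1) y)) (h := h)
    (fun y => by rw [hα0 _ _ (by rw [mem_rect]; omega), zero_mul]) (by
      intro x y hx hy hyh
      have h1 := hαg x y hx hy hyh
      have h3 : ∀ t : ZMod 2, t + t = 0 := by decide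
      by_cases hxb : x ≤ b
      · have h2 := hαe x (y - 1) hx hxb (by omega) (by omega)
        simp only [sub_add_cancel] at h2 ⊢
        rw [h1, h2]
        linear_combination α x y * (h3 (β x y) + h3 (β (x + 1) y) + h3 (β x (y - 1)) +
          h3 (β (x + 1) (y - 1)))
      · have h4 : α x (y - 1) = 0 := hα0 _ _ (by rw [mem_rect]; omega)
        have h5 : α x y = 0 := hα0 _ _ (by rw [mem_rect]; omega)
        simp only [sub_add_cancel]
        rw [h1, h4, h5]
        ring)
  simp only [sub_add_cancel, add_sub_cancel_right] at hwe hwg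
  have hstep : ∀ f f', f ∈ rect 0 (b + 1) 0 (h - 1) → f' ∈ rect 0 (b + 1) 0 (h - 1) →
      (f ∈ G ↔ f' ∈ G) → BondOpen (fun _ => true) f f' → w f.1 f.2 = w f'.1 f'.2 := by
    intro f f' h1 h2 hi hs
    revert h1 h2 hi
    refine hs.elim (P := fun f f' => f ∈ rect 0 (b + 1) 0 (h - 1) →
      f' ∈ rect 0 (b + 1) 0 (h - 1) → (f ∈ G ↔ f' ∈ G) → w f.1 f.2 = w f'.1 f'.2) ?_ ?_ ?_ ?_ <;>
    · intro x y _ h1 h2 hi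
      simp only [mem_rect] at h1 h2
      first
      | rw [hwe x y (by omega), hβi x y (x + 1) y (by tauto), mul_zero, add_zero]
      | rw [hwg x y (by omega) (by omega) (by omega), hβi x y x (y + 1) (by tauto), mul_zero,
          add_zero]
  have hwF : ∀ f ∈ F, w f.1 f.2 = 0 := by
    rintro f ⟨l, hl, hl0, hc⟩
    induction hc with
    | refl => rw [hl0, hw0]
    | tail hc hs ih =>
      have hnG : ∀ f, OpenConn (dualCfg ω) (rect 0 (b + 1) 0 (h - 1)) l f → f ∉ G :=
        fun f hf hfG => (rightComponent_subset _ _ _ hfG).2 ⟨l, hl, hl0, hf⟩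
      rw [← ih, hstep _ _ hs.2.1 hs.1 (iff_of_false (hnG _ (hc.tail hs)) (hnG _ hc))
        (hs.2.2.symm.mono fun _ _ => rfl)]
  have hwU : ∀ k : ℕ, ∀ y, ((k : ℤ), y) ∈ rect 0 (b + 1) 0 (h - 1) → ((k : ℤ), y) ∉ G →
      w k y = 0 := by
    intro k y
    induction k with
    | zero => intro _ _; exact hw0 y
    | succ k ih =>
      intro h1 h2
      by_cases h3 : (((k + 1 : ℕ) : ℤ), y) ∈ F
      · exact hwF _ h3
      have h4 : ((k : ℤ), y) ∈ rect 0 (b + 1) 0 (h - 1) := by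
        simp only [mem_rect, Nat.cast_add] at h1 ⊢
        omega
      have h5 : BondOpen (fun _ => true) ((k : ℤ), y) (((k + 1 : ℕ) : ℤ), y) := by
        push_cast
        exact bondOpen_right rfl
      have h6 : ((k : ℤ), y) ∉ G := fun h6 => h2 (mem_rightComponent_of_bondOpen h6 h1 h3 h5)
      rw [← ih h4 h6]
      exact (hstep _ _ h4 h1 (iff_of_false h6 h2) h5).symm
  have hwU' : ∀ x y, (x, y) ∈ rect 0 (b + 1) 0 (h - 1) → (x, y) ∉ G → w x y = 0 := by
    intro x y h1
    obtain ⟨k, rfl⟩ := Int.eq_ofNat_of_zero_le (mem_rect.1 h1).1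
    exact hwU k y h1
  have hright : ∀ y, 0 ≤ y → y < h → (b + 1, y) ∈ G := fun y hy hyh =>
    ⟨(b + 1, y), ⟨by rw [mem_rect]; omega,
      fun hF => hω (mem_HCross_dualCfg_iff.2 ⟨_, hF, rfl⟩)⟩, rfl, .refl⟩
  have hwr : ∀ k : ℕ, (k : ℤ) < h → w (b + 1) k = w (b + 1) 0 := by
    intro k
    induction k with
    | zero => intro _; rfl
    | succ k ih =>
      intro hk
      push_cast at hk ⊢
      rw [← ih (by omega)]
      exact hstep (b + 1, k + 1) (b + 1, k) (by rw [mem_rect]; omega) (by rw [mem_rect]; omega)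
        (iff_of_true (hright _ (by omega) hk) (hright _ (by omega) (by omega)))
        (bondOpen_up rfl).symm
  have hwG : ∀ f ∈ G, w f.1 f.2 = w (b + 1) 0 := by
    rintro f ⟨r, hr, hrb, hc⟩
    induction hc with
    | refl =>
      obtain ⟨r1, r2⟩ := r
      simp only at hrb
      subst hrb
      have := mem_rect.1 hr.1
      obtain ⟨k, rfl⟩ := Int.eq_ofNat_of_zero_le this.2.2.1
      exact hwr k (by omega)
    | tail hc hs ih =>
      rw [← ih, hstep _ _ hs.2.1.1 hs.1.1
        (iff_of_true ⟨r, hr, hrb, hc.tail hs⟩ ⟨r, hr, hrb, hc⟩)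
        (hs.2.2.symm.mono fun _ _ => rfl)]
  have hwz : w (b + 1) 0 = 0 → ∀ x y, (x, y) ∈ rect 0 (b + 1) 0 (h - 1) → w x y = 0 := by
    intro h0 x y hxy
    by_cases hxyG : (x, y) ∈ G
    · rw [← h0]
      exact hwG _ hxyG
    · exact hwU' x y hxy hxyG
  have hβne : ∀ x y x' y', ¬((x, y) ∈ G ↔ (x', y') ∈ G) → β x y + β x' y' = 1 := by
    intro x y x' y' hi
    simp only [hβ]
    by_cases h1 : (x, y) ∈ G <;> by_cases h2 : (x', y') ∈ G <;>
      simp only [h1, h2, if_true, if_false, zero_add, add_zero, not_true, iff_self] at hi ⊢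
  have hvA : v ∈ A ∧ w (b + 1) 0 ≠ 0 := by
    rcases hv with ⟨x, y, h1, h2, hi, hv⟩ | ⟨x, y, h1, h2, hi, hv⟩
    · have hs := open_of_separated_vert h1 h2 hi
      have hvR : v ∈ rect 0 b 0 h := by
        rcases hv with rfl | rfl
        exacts [hs.1, hs.2.1]
      have hvA : v ∈ A := ⟨hvR, .refl⟩
      refine ⟨hvA, fun h0 => ?_⟩
      have hxA : (x, y) ∈ A := by
        rcases hv with rfl | rfl
        exacts [hvA, (hAs _ _ hs).2 hvA]
      have := hwe x y (mem_rect.1 h1).1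
      rw [hwz h0 _ _ h1, hwz h0 _ _ h2, hβne _ _ _ _ hi] at this
      simp [hα, hxA] at this
    · have hs := open_of_separated_horiz hω h1 h2 hi
      have hvR : v ∈ rect 0 b 0 h := by
        rcases hv with rfl | rfl
        exacts [hs.1, hs.2.1]
      have hvA : v ∈ A := ⟨hvR, .refl⟩
      refine ⟨hvA, fun h0 => ?_⟩
      have hxA : (x - 1, y) ∈ A := by
        rcases hv with rfl | rfl
        exacts [hvA, (hAs _ _ hs).2 hvA]
      have := hwg x (y - 1) (mem_rect.1 h1).1 (mem_rect.1 h1).2.2.1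
        (by have := (mem_rect.1 h2).2.2.2; omega)
      simp only [sub_add_cancel] at this
      rw [hwz h0 _ _ h1, hwz h0 _ _ h2, hβne _ _ _ _ hi] at this
      simp [hα, hxA] at this
  have hrow : ∀ y, 0 ≤ y → y < h → ∃ x, (x, y) ∈ A ∧ (x, y + 1) ∈ A := by
    intro y hy hyh
    obtain ⟨x, hx, hxb, h1, h2⟩ := exists_separated_in_row hb hω hy hyh
    have hR1 : (x, y) ∈ rect 0 (b + 1) 0 (h - 1) := by rw [mem_rect]; omega
    have hR2 : (x + 1, y) ∈ rect 0 (b + 1) 0 (h - 1) := by rw [mem_rect]; omega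
    have hs := hAs _ _ (open_of_separated_vert hR1 hR2 (by tauto))
    have hxA : (x, y) ∈ A := by
      by_contra hxA
      have := hwe x y hx
      rw [hwU' _ _ hR1 h1, show w (x + 1) y = w (b + 1) 0 from hwG _ h2] at this
      simp [hα, hxA, hvA.2] at this
    exact ⟨x, hxA, hs.1 hxA⟩
  obtain ⟨x, h1, -⟩ := hrow 0 le_rfl hh
  obtain ⟨x', -, h2⟩ := hrow (h - 1) (by omega) (by omega)
  exact ⟨_, _, rfl, by simp, h1.1, h1.2, h2.2⟩

/-- If there is no dual open left-to-right path, there is an open top-to-bottom path. -/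
lemma VCross_of_not_HCross_dualCfg (hb : 0 ≤ b) (hh : 0 < h)
    (hω : dualCfg ω ∉ HCross 0 (b + 1) 0 (h - 1)) : ω ∈ VCross 0 b 0 h := by
  obtain ⟨x, hx, hxb, h1, h2⟩ := exists_separated_in_row hb hω le_rfl hh
  obtain ⟨t, t', ht, ht', hv, hc, hc'⟩ := OnInterface.exists_conn hb hh hω (v := (x, 0))
    (Or.inl ⟨x, 0, by rw [mem_rect]; omega, by rw [mem_rect]; omega, by tauto, Or.inl rfl⟩)
  exact mem_VCross_iff.2 ⟨t, t', OpenConn.mem hc hv, ht, ht',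
    Relation.ReflTransGen.trans (OpenConn.symm hc) hc'⟩

end Interface

/-- The event `E` only depends on the bonds in `s`. -/
def DeterminedBy (s : Finset GridBond) (E : Set PercCfg) : Prop :=
  ∀ ω ω' : PercCfg, (∀ e ∈ s, ω e = ω' e) → ω ∈ E → ω' ∈ E

lemma DeterminedBy.mono {s t : Finset GridBond} {E : Set PercCfg} (h : DeterminedBy s E)
    (hst : s ⊆ t) : DeterminedBy t E := fun ω ω' he => h ω ω' fun e hes => he e (hst hes)

lemma DeterminedBy.mem_iff {s : Finset GridBond} {E : Set PercCfg} (h : DeterminedBy s E)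
    {ω ω' : PercCfg} (he : ∀ e ∈ s, ω e = ω' e) : ω ∈ E ↔ ω' ∈ E :=
  ⟨h ω ω' he, h ω' ω fun e hes => (he e hes).symm⟩

lemma DeterminedBy.inter {s : Finset GridBond} {E E' : Set PercCfg} (h : DeterminedBy s E)
    (h' : DeterminedBy s E') : DeterminedBy s (E ∩ E') := fun ω ω' he hω =>
  ⟨h ω ω' he hω.1, h' ω ω' he hω.2⟩

/-- The configuration whose open bonds are those of `A`. -/
def cfgOf {s : Finset GridBond} (A : Finset s) : PercCfg :=
  fun e => decide (e ∈ A.map (Function.Embedding.subtype _))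

/-- The configurations on `s`, encoded by their open bonds, which belong to `E`. -/
noncomputable def patterns (s : Finset GridBond) (E : Set PercCfg) : Finset (Finset s) := by
  classical exact Finset.univ.filter fun A => cfgOf A ∈ E

lemma mem_patterns {s : Finset GridBond} {E : Set PercCfg} {A : Finset s} :
    A ∈ patterns s E ↔ cfgOf A ∈ E := by
  simp [patterns]

/-- The event that the configuration restricted to `s` is given by `A`. -/
def cylinderOf {s : Finset GridBond} (A : Finset s) : Set PercCfg :=
  {ω | ∀ e ∈ s, ω e = cfgOf A e}

lemma measurableSet_forall_eq (s : Finset GridBond) (f : GridBond → Bool) :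
    MeasurableSet {ω : PercCfg | ∀ e ∈ s, ω e = f e} := by
  have : {ω : PercCfg | ∀ e ∈ s, ω e = f e} = ⋂ e ∈ s, (fun ω : PercCfg => ω e) ⁻¹' {f e} := by
    ext; simp
  rw [this]
  exact Finset.measurableSet_biInter _ fun e _ => measurable_pi_apply e (measurableSet_singleton _)

lemma exists_mem_cylinderOf (s : Finset GridBond) (ω : PercCfg) :
    ∃ A : Finset s, ω ∈ cylinderOf A := by
  refine ⟨Finset.univ.filter fun e => ω e = true, fun e he => ?_⟩
  cases h : ω e <;> simp [cfgOf, h, he]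

lemma disjoint_cylinderOf {s : Finset GridBond} {A B : Finset s} (hAB : A ≠ B) :
    Disjoint (cylinderOf A) (cylinderOf B) := by
  rw [Set.disjoint_left]
  intro ω hA hB
  refine hAB (Finset.ext fun e => ?_)
  have h := (hA e e.2).symm.trans (hB e e.2)
  simpa [cfgOf] using h

lemma DeterminedBy.eq_biUnion {s : Finset GridBond} {E : Set PercCfg} (h : DeterminedBy s E) :
    E = ⋃ A ∈ patterns s E, cylinderOf A := by
  ext ω
  simp only [Set.mem_iUnion, mem_patterns]
  constructor
  · intro hω
    obtain ⟨A, hA⟩ := exists_mem_cylinderOf s ω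
    exact ⟨A, h _ _ hA hω, hA⟩
  · rintro ⟨A, hA, hω⟩
    exact (h.mem_iff hω).2 hA

lemma DeterminedBy.measurableSet {s : Finset GridBond} {E : Set PercCfg} (h : DeterminedBy s E) :
    MeasurableSet E := by
  rw [h.eq_biUnion]
  exact Finset.measurableSet_biUnion _ fun A _ => measurableSet_forall_eq _ _

lemma IsBondPerc.real_cylinderOf {Pr : Measure PercCfg} (hPr : IsBondPerc Pr)
    {s : Finset GridBond} (A : Finset s) : Pr.real (cylinderOf A) = (1 / 2) ^ s.card := by
  rw [measureReal_def, cylinderOf, hPr.2]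
  simp

lemma IsBondPerc.real_eq {Pr : Measure PercCfg} (hPr : IsBondPerc Pr) {s : Finset GridBond}
    {E : Set PercCfg} (h : DeterminedBy s E) :
    Pr.real E = (patterns s E).card * (1 / 2) ^ s.card := by
  have := hPr.1
  conv_lhs => rw [h.eq_biUnion]
  rw [measureReal_biUnion_finset (fun A _ B _ hAB => disjoint_cylinderOf hAB)
    fun A _ => measurableSet_forall_eq _ _]
  simp [hPr.real_cylinderOf]

/-- Events determined by disjoint sets of bonds are independent. -/
lemma IsBondPerc.real_inter_eq_mul {Pr : Measure PercCfg} (hPr : IsBondPerc Pr)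
    {s t : Finset GridBond} {E E' : Set PercCfg} (h : DeterminedBy s E) (h' : DeterminedBy t E')
    (hst : Disjoint s t) : Pr.real (E ∩ E') = Pr.real E * Pr.real E' := by
  classical
  have := hPr.1
  have hEq : E ∩ E' = ⋃ p ∈ patterns s E ×ˢ patterns t E', cylinderOf p.1 ∩ cylinderOf p.2 := by
    conv_lhs => rw [h.eq_biUnion, h'.eq_biUnion]
    ext ω
    simp only [Set.mem_inter_iff, Set.mem_iUnion, Finset.mem_product, Prod.exists, exists_prop]
    constructor
    · rintro ⟨⟨A, hA, hA'⟩, B, hB, hB'⟩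
      exact ⟨A, B, ⟨hA, hB⟩, hA', hB'⟩
    · rintro ⟨A, B, ⟨hA, hB⟩, hA', hB'⟩
      exact ⟨⟨A, hA, hA'⟩, B, hB, hB'⟩
  have hcyl : ∀ (A : Finset s) (B : Finset t),
      Pr.real (cylinderOf A ∩ cylinderOf B) = (1 / 2) ^ s.card * (1 / 2) ^ t.card := by
    intro A B
    have : cylinderOf A ∩ cylinderOf B =
        {ω | ∀ e ∈ s ∪ t, ω e = if e ∈ s then cfgOf A e else cfgOf B e} := by
      ext ω
      simp only [cylinderOf, Set.mem_inter_iff, Set.mem_ofPred_eq, Finset.mem_union]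
      constructor
      · rintro ⟨hA, hB⟩ e he
        by_cases hes : e ∈ s
        · rw [if_pos hes, hA e hes]
        · rw [if_neg hes, hB e (he.resolve_left hes)]
      · intro hω
        refine ⟨fun e he => by simpa [he] using hω e (Or.inl he), fun e he => ?_⟩
        simpa [Finset.disjoint_right.1 hst he] using hω e (Or.inr he)
    rw [this, measureReal_def, hPr.2, Finset.card_union_of_disjoint hst]
    simp [pow_add]
  rw [hEq, measureReal_biUnion_finset, hPr.real_eq h, hPr.real_eq h']
  · simp only [hcyl, Finset.sum_const, Finset.card_product, nsmul_eq_mul, Nat.cast_mul]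
    ring
  · rintro ⟨A, B⟩ _ ⟨A', B'⟩ _ hne
    by_cases hA : A = A'
    · have hB : B ≠ B' := fun hB => hne (by rw [hA, hB])
      exact (disjoint_cylinderOf hB).mono Set.inter_subset_right Set.inter_subset_right
    · exact (disjoint_cylinderOf hA).mono Set.inter_subset_left Set.inter_subset_left
  · exact fun p _ => (measurableSet_forall_eq _ _).inter (measurableSet_forall_eq _ _)

/-- The event `E` is preserved when bonds are opened. -/
def Increasing (E : Set PercCfg) : Prop :=
  ∀ ω ω' : PercCfg, (∀ e, ω e = true → ω' e = true) → ω ∈ E → ω' ∈ E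

lemma Increasing.inter {E E' : Set PercCfg} (h : Increasing E) (h' : Increasing E') :
    Increasing (E ∩ E') := fun ω ω' hω hE => ⟨h ω ω' hω hE.1, h' ω ω' hω hE.2⟩

lemma Increasing.isUpperSet_patterns {E : Set PercCfg} (h : Increasing E) (s : Finset GridBond) :
    IsUpperSet (patterns s E : Set (Finset s)) := by
  intro A B hAB hA
  rw [Finset.mem_coe, mem_patterns] at hA ⊢
  refine h _ _ (fun e he => ?_) hA
  simp only [cfgOf, decide_eq_true_eq] at he ⊢
  exact Finset.map_subset_map.2 hAB he

/-- **Harris' inequality**: increasing events are positively correlated. -/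
lemma IsBondPerc.mul_le_real_inter {Pr : Measure PercCfg} (hPr : IsBondPerc Pr)
    {s : Finset GridBond} {E E' : Set PercCfg} (h : DeterminedBy s E) (h' : DeterminedBy s E')
    (hE : Increasing E) (hE' : Increasing E') :
    Pr.real E * Pr.real E' ≤ Pr.real (E ∩ E') := by
  classical
  rw [hPr.real_eq h, hPr.real_eq h', hPr.real_eq (h.inter h')]
  have key := (hE.isUpperSet_patterns s).le_card_inter_finset (hE'.isUpperSet_patterns s)
  have hi : patterns s E ∩ patterns s E' = patterns s (E ∩ E') := by
    ext A; simp [mem_patterns]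
  rw [hi, Fintype.card_coe] at key
  have key' : ((patterns s E).card : ℝ) * (patterns s E').card ≤
      2 ^ s.card * (patterns s (E ∩ E')).card := by exact_mod_cast key
  have h2 : (2 : ℝ) ^ s.card * (1 / 2) ^ s.card = 1 := by
    rw [← mul_pow]; norm_num
  calc _ = ((patterns s E).card * (patterns s E').card : ℝ) * ((1 / 2) ^ s.card *
        (1 / 2) ^ s.card) := by ring
    _ ≤ (2 ^ s.card * (patterns s (E ∩ E')).card) * ((1 / 2) ^ s.card * (1 / 2) ^ s.card) := by
        gcongr
    _ = (2 ^ s.card * (1 / 2) ^ s.card) * ((patterns s (E ∩ E')).card * (1 / 2) ^ s.card) := by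
        ring
    _ = _ := by rw [h2, one_mul]

/-- Relabelling the bonds by a permutation, and possibly exchanging open and closed, preserves the
probability of local events. -/
lemma IsBondPerc.real_preimage_relabel {Pr : Measure PercCfg} (hPr : IsBondPerc Pr)
    (σ : GridBond ≃ GridBond) (flip : Bool) {s : Finset GridBond} {E : Set PercCfg}
    (h : DeterminedBy s E) :
    Pr.real {ω | (fun e => xor flip (ω (σ e))) ∈ E} = Pr.real E := by
  classical
  have := hPr.1
  set φ : PercCfg → PercCfg := fun ω e => xor flip (ω (σ e)) with hφ
  have hm : Measurable φ := measurable_pi_lambda _ fun e =>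
    (measurable_from_top (f := xor flip)).comp (measurable_pi_apply _)
  have hmap : IsBondPerc (Pr.map φ) := by
    refine ⟨Measure.isProbabilityMeasure_map hm.aemeasurable, fun t f => ?_⟩
    rw [Measure.map_apply hm (measurableSet_forall_eq _ _)]
    have : φ ⁻¹' {ω | ∀ e ∈ t, ω e = f e} =
        {ω | ∀ e ∈ t.map σ.toEmbedding, ω e = xor flip (f (σ.symm e))} := by
      ext ω
      simp only [hφ, Set.mem_preimage, Set.mem_ofPred_eq, Finset.mem_map, Equiv.coe_toEmbedding,
        forall_exists_index, and_imp, forall_apply_eq_imp_iff₂, Equiv.symm_apply_apply]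
      refine forall₂_congr fun e _ => ?_
      cases flip <;> cases ω (σ e) <;> cases f e <;> decide
    rw [this, hPr.2, Finset.card_map]
  rw [hPr.real_eq h, ← hmap.real_eq h, map_measureReal_apply hm h.measurableSet]
  rfl

/-! ### Symmetries of the lattice -/

lemma OpenConn.map {ω ω' : PercCfg} {D D' : Set (ℤ × ℤ)} {τ : ℤ × ℤ → ℤ × ℤ} {u v : ℤ × ℤ}
    (h : OpenConn ω D u v) (hτ : ∀ u v, BondOpen ω u v → BondOpen ω' (τ u) (τ v))
    (hD : ∀ v ∈ D, τ v ∈ D') : OpenConn ω' D' (τ u) (τ v) := by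
  induction h with
  | refl => exact .refl
  | tail _ h ih => exact ih.tail ⟨hD _ h.1, hD _ h.2.1, hτ _ _ h.2.2⟩

/-- The action on bonds of the reflection `(x, y) ↦ (r - x, y)`. -/
def reflectX (r : ℤ) : GridBond ≃ GridBond :=
  Function.Involutive.toPerm
    (fun e => match e with
      | ((x, y), true) => ((r - x - 1, y), true)
      | ((x, y), false) => ((r - x, y), false))
    (by rintro ⟨⟨x, y⟩, _ | _⟩ <;> simp; omega)

/-- The action on bonds of the reflection `(x, y) ↦ (x, r - y)`. -/
def reflectY (r : ℤ) : GridBond ≃ GridBond :=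
  Function.Involutive.toPerm
    (fun e => match e with
      | ((x, y), true) => ((x, r - y), true)
      | ((x, y), false) => ((x, r - y - 1), false))
    (by rintro ⟨⟨x, y⟩, _ | _⟩ <;> simp; omega)

/-- The action on bonds of the reflection `(x, y) ↦ (y, x)`. -/
def transposeBond : GridBond ≃ GridBond :=
  Function.Involutive.toPerm (fun e => ((e.1.2, e.1.1), !e.2)) (by intro e; simp)

/-- The correspondence between dual bonds and the bonds they cross. -/
def crossedBond : GridBond ≃ GridBond where
  toFun := fun e => match e with
    | ((x, y), true) => ((x, y), false)
    | ((x, y), false) => ((x - 1, y + 1), true)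
  invFun := fun e => match e with
    | ((x, y), true) => ((x + 1, y - 1), false)
    | ((x, y), false) => ((x, y), true)
  left_inv := by rintro ⟨⟨x, y⟩, _ | _⟩ <;> simp
  right_inv := by rintro ⟨⟨x, y⟩, _ | _⟩ <;> simp

@[simp] lemma reflectX_reflectX (r : ℤ) (e : GridBond) : reflectX r (reflectX r e) = e :=
  Function.Involutive.toPerm_involutive _ e

@[simp] lemma reflectY_reflectY (r : ℤ) (e : GridBond) : reflectY r (reflectY r e) = e :=
  Function.Involutive.toPerm_involutive _ e

@[simp] lemma transposeBond_transposeBond (e : GridBond) :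
    transposeBond (transposeBond e) = e :=
  Function.Involutive.toPerm_involutive _ e

@[simp] lemma reflectX_apply (r x y : ℤ) (o : Bool) :
    reflectX r ((x, y), o) = ((if o then r - x - 1 else r - x, y), o) := by
  cases o <;> rfl

@[simp] lemma reflectY_apply (r x y : ℤ) (o : Bool) :
    reflectY r ((x, y), o) = ((x, if o then r - y else r - y - 1), o) := by
  cases o <;> rfl

@[simp] lemma transposeBond_apply (x y : ℤ) (o : Bool) :
    transposeBond ((x, y), o) = ((y, x), !o) := rfl

lemma BondOpen.reflectX {ω : PercCfg} {u v : ℤ × ℤ} (r : ℤ) (h : BondOpen ω u v) :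
    BondOpen (fun e => ω (reflectX r e)) (r - u.1, u.2) (r - v.1, v.2) := by
  refine h.elim (P := fun u v => BondOpen (fun e => ω (_root_.reflectX r e))
    (r - u.1, u.2) (r - v.1, v.2)) ?_ ?_ ?_ ?_ <;> intro x y hω
  · exact Or.inr (Or.inl ⟨by ext <;> simp; omega, by simpa using hω⟩)
  · exact Or.inl ⟨by ext <;> simp; omega, by simpa using hω⟩
  · exact Or.inr (Or.inr (Or.inl ⟨by simp, by simpa using hω⟩))
  · exact Or.inr (Or.inr (Or.inr ⟨by simp, by simpa using hω⟩))

lemma BondOpen.reflectY {ω : PercCfg} {u v : ℤ × ℤ} (r : ℤ) (h : BondOpen ω u v) :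
    BondOpen (fun e => ω (reflectY r e)) (u.1, r - u.2) (v.1, r - v.2) := by
  refine h.elim (P := fun u v => BondOpen (fun e => ω (_root_.reflectY r e))
    (u.1, r - u.2) (v.1, r - v.2)) ?_ ?_ ?_ ?_ <;> intro x y hω
  · exact Or.inl ⟨by simp, by simpa using hω⟩
  · exact Or.inr (Or.inl ⟨by simp, by simpa using hω⟩)
  · exact Or.inr (Or.inr (Or.inr ⟨by ext <;> simp; omega, by simpa using hω⟩))
  · exact Or.inr (Or.inr (Or.inl ⟨by ext <;> simp; omega, by simpa using hω⟩))

lemma BondOpen.transpose {ω : PercCfg} {u v : ℤ × ℤ} (h : BondOpen ω u v) :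
    BondOpen (fun e => ω (transposeBond e)) u.swap v.swap := by
  refine h.elim (P := fun u v => BondOpen (fun e => ω (transposeBond e)) u.swap v.swap)
    ?_ ?_ ?_ ?_ <;> intro x y hω
  · exact Or.inr (Or.inr (Or.inl ⟨by simp, by simpa using hω⟩))
  · exact Or.inr (Or.inr (Or.inr ⟨by simp, by simpa using hω⟩))
  · exact Or.inl ⟨by simp, by simpa using hω⟩
  · exact Or.inr (Or.inl ⟨by simp, by simpa using hω⟩)

lemma dualCfg_eq (ω : PercCfg) : (fun e => xor true (ω (crossedBond e))) = dualCfg ω := by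
  funext e
  rcases e with ⟨⟨x, y⟩, _ | _⟩ <;> simp [crossedBond]

/-- The endpoint of a bond which is not its base point. -/
def bondEnd : GridBond → ℤ × ℤ
  | ((x, y), true) => (x + 1, y)
  | ((x, y), false) => (x, y + 1)

/-- The bonds whose base point lies in `[a,b] × [c,d]`. -/
noncomputable def bondsIn (a b c d : ℤ) : Finset GridBond :=
  (Finset.Icc a b ×ˢ Finset.Icc c d) ×ˢ Finset.univ

lemma mem_bondsIn {a b c d : ℤ} {e : GridBond} :
    e ∈ bondsIn a b c d ↔ e.1 ∈ rect a b c d := by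
  obtain ⟨⟨x, y⟩, o⟩ := e
  simp only [bondsIn, Finset.mem_product, Finset.mem_Icc, Finset.mem_univ, and_true, mem_rect]
  tauto

lemma BondOpen.congr {ω ω' : PercCfg} {u v : ℤ × ℤ} (h : BondOpen ω u v)
    (hω : ∀ e : GridBond, (e.1 = u ∧ bondEnd e = v) ∨ (e.1 = v ∧ bondEnd e = u) → ω e = ω' e) :
    BondOpen ω' u v := by
  revert hω
  refine h.elim (P := fun u v => (∀ e : GridBond, (e.1 = u ∧ bondEnd e = v) ∨
    (e.1 = v ∧ bondEnd e = u) → ω e = ω' e) → BondOpen ω' u v) ?_ ?_ ?_ ?_ <;>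
  intro x y h1 h2
  · exact bondOpen_right (by rw [← h2 ((x, y), true) (Or.inl ⟨rfl, rfl⟩), h1])
  · exact (bondOpen_right (by rw [← h2 ((x, y), true) (Or.inr ⟨rfl, rfl⟩), h1])).symm
  · exact bondOpen_up (by rw [← h2 ((x, y), false) (Or.inl ⟨rfl, rfl⟩), h1])
  · exact (bondOpen_up (by rw [← h2 ((x, y), false) (Or.inr ⟨rfl, rfl⟩), h1])).symm

lemma OpenConn.congr {ω ω' : PercCfg} {D : Set (ℤ × ℤ)} {u v : ℤ × ℤ} (h : OpenConn ω D u v)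
    (hω : ∀ e : GridBond, e.1 ∈ D → bondEnd e ∈ D → ω e = ω' e) : OpenConn ω' D u v := by
  induction h with
  | refl => exact .refl
  | tail _ h ih =>
    refine ih.tail ⟨h.1, h.2.1, h.2.2.congr ?_⟩
    rintro e (⟨h1, h2⟩ | ⟨h1, h2⟩)
    · exact hω e (h1 ▸ h.1) (h2 ▸ h.2.1)
    · exact hω e (h1 ▸ h.2.1) (h2 ▸ h.1)

lemma determinedBy_HCross (a b c d : ℤ) : DeterminedBy (bondsIn a b c d) (HCross a b c d) := by
  intro ω ω' he hω
  obtain ⟨u, v, hu, hua, hvb, hc⟩ := mem_HCross_iff.1 hω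
  exact mem_HCross_iff.2 ⟨u, v, hu, hua, hvb, hc.congr fun e h _ => he e (mem_bondsIn.2 h)⟩

lemma increasing_HCross (a b c d : ℤ) : Increasing (HCross a b c d) := by
  intro ω ω' he hω
  obtain ⟨u, v, hu, hua, hvb, hc⟩ := mem_HCross_iff.1 hω
  exact mem_HCross_iff.2 ⟨u, v, hu, hua, hvb, hc.mono he subset_rfl⟩

lemma HCross_mono {a b c d c' d' : ℤ} (hc : c' ≤ c) (hd : d ≤ d') :
    HCross a b c d ⊆ HCross a b c' d' := by
  have hR : rect a b c d ⊆ rect a b c' d' := by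
    rintro ⟨x, y⟩ h
    rw [mem_rect] at h ⊢
    omega
  intro ω hω
  obtain ⟨u, v, hu, hua, hvb, h⟩ := mem_HCross_iff.1 hω
  exact mem_HCross_iff.2 ⟨u, v, hR hu, hua, hvb, h.mono (fun _ => id) hR⟩

lemma VCross_subset_of_le {a a' d d' : ℤ} (ha : a ≤ a') (hd : 0 ≤ d) (hdd : d ≤ d') :
    VCross 0 a 0 d' ⊆ VCross 0 a' 0 d := by
  intro ω hω
  obtain ⟨u, v, hu, hu0, hvd, h⟩ := mem_VCross_iff.1 hω
  have hu' : u ∈ rect 0 a' 0 d := by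
    obtain ⟨x, y⟩ := u
    simp only [mem_rect] at hu hu0 ⊢
    omega
  have key : (v.2 ≤ d ∧ OpenConn ω (rect 0 a' 0 d) u v) ∨
      ∃ v', v'.2 = d ∧ OpenConn ω (rect 0 a' 0 d) u v' := by
    clear hvd
    induction h with
    | refl => exact Or.inl ⟨hu0 ▸ hd, .refl⟩
    | @tail v w _ hs ih =>
      rcases ih with ⟨hv, hc⟩ | h
      · rcases hv.eq_or_lt with hv | hv
        · exact Or.inr ⟨v, hv, hc⟩
        · have hw : w.2 ≤ v.2 + 1 := by
            rcases hs.2.2 with ⟨h, -⟩ | ⟨h, -⟩ | ⟨h, -⟩ | ⟨h, -⟩ <;>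
              simp [h]; omega
          have hvR := OpenConn.mem hc hu'
          refine Or.inl ⟨by omega, hc.tail ⟨hvR, ?_, hs.2.2⟩⟩
          have := hs.2.1
          obtain ⟨x, y⟩ := w
          simp only [mem_rect] at this hw ⊢
          omega
      · exact Or.inr h
  rcases key with ⟨hv, hc⟩ | ⟨v', hv', hc⟩
  · exact mem_VCross_iff.2 ⟨u, v, hu', hu0, by omega, hc⟩
  · exact mem_VCross_iff.2 ⟨u, v', hu', hu0, hv', hc⟩

lemma IsBondPerc.real_preimage_symm {Pr : Measure PercCfg} (hPr : IsBondPerc Pr)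
    (σ : GridBond ≃ GridBond) {s : Finset GridBond}
    {E : Set PercCfg} (h : DeterminedBy s E) :
    Pr.real {ω | (fun e => ω (σ e)) ∈ E} = Pr.real E := by
  simpa using hPr.real_preimage_relabel σ false h

lemma IsBondPerc.real_preimage_dualCfg {Pr : Measure PercCfg} (hPr : IsBondPerc Pr)
    {s : Finset GridBond} {E : Set PercCfg}
    (h : DeterminedBy s E) : Pr.real {ω | dualCfg ω ∈ E} = Pr.real E := by
  rw [← hPr.real_preimage_relabel crossedBond true h]
  simp only [dualCfg_eq]

lemma IsBondPerc.real_VCross {Pr : Measure PercCfg} (hPr : IsBondPerc Pr) (a b c d : ℤ) :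
    Pr.real (VCross a b c d) = Pr.real (HCross c d a b) := by
  have := hPr.1
  rw [← hPr.real_preimage_symm transposeBond (determinedBy_HCross c d a b)]
  congr 1
  ext ω
  simp only [Set.mem_ofPred_eq, mem_HCross_iff, mem_VCross_iff]
  constructor
  · rintro ⟨u, v, hu, huc, hvd, h⟩
    exact ⟨u.swap, v.swap, ⟨hu.2.2.1, hu.2.2.2, hu.1, hu.2.1⟩, huc, hvd,
      h.map (fun _ _ => BondOpen.transpose) fun _ hu => ⟨hu.2.2.1, hu.2.2.2, hu.1, hu.2.1⟩⟩
  · rintro ⟨u, v, hu, huc, hvd, h⟩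
    refine ⟨u.swap, v.swap, ⟨hu.2.2.1, hu.2.2.2, hu.1, hu.2.1⟩, huc, hvd,
      h.map (fun a b hab => ?_) fun _ hu => ⟨hu.2.2.1, hu.2.2.2, hu.1, hu.2.1⟩⟩
    simpa using hab.transpose

lemma IsBondPerc.half_le_HCross {Pr : Measure PercCfg} (hPr : IsBondPerc Pr) {w : ℤ} (hw : 0 ≤ w) :
    1 / 2 ≤ Pr.real (HCross 0 (w + 1) 0 w) := by
  have := hPr.1
  have hdet := determinedBy_HCross 0 (w + 1) 0 w
  have hdual := hPr.real_preimage_dualCfg hdet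
  have hcover : (Set.univ : Set PercCfg) ⊆
      {ω | dualCfg ω ∈ HCross 0 (w + 1) 0 w} ∪ VCross 0 w 0 (w + 1) := by
    intro ω _
    by_cases h : dualCfg ω ∈ HCross 0 (w + 1) 0 w
    · exact Or.inl h
    · exact Or.inr (VCross_of_not_HCross_dualCfg hw (by omega) (by simpa using h))
  have h1 := (measureReal_mono (μ := Pr) hcover).trans (measureReal_union_le _ _)
  rw [probReal_univ, hdual, hPr.real_VCross] at h1
  linarith

lemma IsBondPerc.half_le_HCross_square {Pr : Measure PercCfg} (hPr : IsBondPerc Pr)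
    {n : ℤ} (hn : 0 < n) :
    1 / 2 ≤ Pr.real (HCross 0 n 0 n) := by
  have := hPr.1
  have h := hPr.half_le_HCross (w := n - 1) (by omega)
  rw [sub_add_cancel] at h
  exact h.trans (measureReal_mono (HCross_mono le_rfl (by omega)))

lemma IsBondPerc.half_le_not_HCross_dualCfg {Pr : Measure PercCfg} (hPr : IsBondPerc Pr)
    {n : ℤ} (hn : 0 < n) :
    1 / 2 ≤ Pr.real {ω | dualCfg ω ∉ HCross 0 (n + 1) 0 (n - 1)} := by
  have := hPr.1
  refine (hPr.half_le_HCross_square hn).trans ?_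
  rw [← hPr.real_VCross]
  exact measureReal_mono fun ω hω => not_HCross_dualCfg hn.le hn hω

lemma IsBondPerc.real_HCross_reflect {Pr : Measure PercCfg} (hPr : IsBondPerc Pr)
    (a b c d : ℤ) (r : ℤ) :
    Pr.real (HCross a b c d) ≤ Pr.real (HCross (r - b) (r - a) c d) := by
  have := hPr.1
  rw [← hPr.real_preimage_symm (reflectX r) (determinedBy_HCross (r - b) (r - a) c d)]
  refine measureReal_mono fun ω hω => ?_
  obtain ⟨u, v, hu, hua, hvb, h⟩ := mem_HCross_iff.1 hω
  have hR : ∀ z ∈ rect a b c d, (r - z.1, z.2) ∈ rect (r - b) (r - a) c d := by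
    rintro ⟨x, y⟩ h
    simp only [mem_rect] at h ⊢
    omega
  have h' := h.map (fun _ _ => BondOpen.reflectX r) hR
  exact mem_HCross_iff.2 ⟨_, _, OpenConn.mem h' (hR _ hu), by simp [hvb], by simp [hua], h'.symm⟩

/-! ### Exploring the interface -/

/-- `v` is a corner of the square `f`. -/
def IsCornerOf (f v : ℤ × ℤ) : Prop :=
  (v.1 = f.1 - 1 ∨ v.1 = f.1) ∧ (v.2 = f.2 ∨ v.2 = f.2 + 1)

/-- The four sides of the square `f`. -/
def squareBonds : ℤ × ℤ → Finset GridBond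
  | (x, y) => {((x - 1, y), false), ((x, y), false), ((x - 1, y), true), ((x - 1, y + 1), true)}

lemma isCorner_of_mem_squareBonds {f : ℤ × ℤ} {e : GridBond} (he : e ∈ squareBonds f) :
    IsCornerOf f e.1 ∧ IsCornerOf f (bondEnd e) := by
  obtain ⟨x, y⟩ := f
  simp only [squareBonds, Finset.mem_insert, Finset.mem_singleton] at he
  rcases he with rfl | rfl | rfl | rfl <;> simp [IsCornerOf, bondEnd]

lemma BondOpen.congr_dualCfg {ω ω' : PercCfg} {f f' : ℤ × ℤ} (h : BondOpen (dualCfg ω) f f')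
    (hω : ∀ e ∈ squareBonds f, ω e = ω' e) : BondOpen (dualCfg ω') f f' := by
  revert hω
  refine h.elim (P := fun f f' => (∀ e ∈ squareBonds f, ω e = ω' e) → BondOpen (dualCfg ω') f f')
    ?_ ?_ ?_ ?_ <;> intro x y h1 h2
  · refine bondOpen_right ?_
    rw [dualCfg_right, ← h2 _ (by simp [squareBonds]), ← dualCfg_right, h1]
  · refine (bondOpen_right ?_).symm
    rw [dualCfg_right, ← h2 _ (by simp [squareBonds]), ← dualCfg_right, h1]
  · refine bondOpen_up ?_
    rw [dualCfg_up, ← h2 _ (by simp [squareBonds]), ← dualCfg_up, h1]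
  · refine (bondOpen_up ?_).symm
    rw [dualCfg_up, ← h2 _ (by simp [squareBonds]), ← dualCfg_up, h1]

lemma leftCluster_subset_leftCluster {ω ω' : PercCfg} {b h : ℤ}
    (hω : ∀ f ∈ leftCluster ω b h, f ∈ leftCluster ω' b h → ∀ e ∈ squareBonds f, ω e = ω' e) :
    leftCluster ω b h ⊆ leftCluster ω' b h := by
  rintro f ⟨l, hl, hl0, hc⟩
  induction hc with
  | refl => exact ⟨l, hl, hl0, .refl⟩
  | @tail v w hc hs ih =>
    exact mem_leftCluster_of_bondOpen ih hs.2.1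
      (hs.2.2.congr_dualCfg (hω v ⟨l, hl, hl0, hc⟩ ih))

lemma determinedBy_leftCluster_eq (b h : ℤ) (F : Finset (ℤ × ℤ)) :
    DeterminedBy (F.biUnion squareBonds) {ω | leftCluster ω b h = F} := by
  intro ω ω' he (hω : leftCluster ω b h = F)
  have key : ∀ f ∈ leftCluster ω b h, ∀ e ∈ squareBonds f, ω e = ω' e := by
    intro f hf e hef
    rw [hω] at hf
    exact he e (Finset.mem_biUnion.2 ⟨f, hf, hef⟩)
  refine Eq.trans (Set.Subset.antisymm ?_ ?_) hω
  · exact leftCluster_subset_leftCluster fun f _ hf e hef => (key f hf e hef).symm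
  · exact leftCluster_subset_leftCluster fun f hf _ e hef => key f hf e hef

/-- The corners of the squares which the set of squares `F` cuts off from the right side of
`[0,n] × [0,n]`. -/
def cutRegion (n : ℤ) (F : Set (ℤ × ℤ)) : Set (ℤ × ℤ) :=
  {v | ∃ f ∈ rect 0 (n + 1) 0 (n - 1) \ rightComponent n n F, IsCornerOf f v}

/-- The union of `cutRegion n F` and its reflection in the top side of `[0,n] × [0,n]`. -/
def symRegion (n : ℤ) (F : Set (ℤ × ℤ)) : Set (ℤ × ℤ) :=
  cutRegion n F ∪ {v | (v.1, 2 * n - v.2) ∈ cutRegion n F}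

/-- Some vertex of `cutRegion n F` is joined to the right side of `[0,m] × [0,2n]` by an open path
which otherwise avoids `symRegion n F`. -/
def exitEvent (n m : ℤ) (F : Set (ℤ × ℤ)) : Set PercCfg :=
  {ω | ∃ v w q, v ∈ cutRegion n F ∧ v ∈ rect 0 m 0 (2 * n) ∧ w ∉ symRegion n F ∧
    w ∈ rect 0 m 0 (2 * n) ∧ BondOpen ω v w ∧ q.1 = m ∧
    OpenConn ω (rect 0 m 0 (2 * n) \ symRegion n F) w q}

/-- A top-bottom crossing of `[0,n] × [0,n]` is joined to the right side of `[0,m] × [0,2n]`. -/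
def hookEvent (n m : ℤ) : Set PercCfg :=
  {ω | ∃ v q t t', v ∈ rect 0 n 0 n ∧ t.2 = 0 ∧ t'.2 = n ∧ q.1 = m ∧
    OpenConn ω (rect 0 n 0 n) v t ∧ OpenConn ω (rect 0 n 0 n) v t' ∧
    OpenConn ω (rect 0 m 0 (2 * n)) v q}

lemma increasing_hookEvent (n m : ℤ) : Increasing (hookEvent n m) := by
  rintro ω ω' he ⟨v, q, t, t', hv, ht, ht', hq, h1, h2, h3⟩
  exact ⟨v, q, t, t', hv, ht, ht', hq, h1.mono he subset_rfl, h2.mono he subset_rfl,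
    h3.mono he subset_rfl⟩

lemma determinedBy_hookEvent {n m : ℤ} (hm : n < m) :
    DeterminedBy (bondsIn 0 m 0 (2 * n)) (hookEvent n m) := by
  have hR : ∀ z ∈ rect 0 n 0 n, z ∈ rect 0 m 0 (2 * n) := by
    rintro ⟨x, y⟩ h
    rw [mem_rect] at h ⊢
    omega
  rintro ω ω' he ⟨v, q, t, t', hv, ht, ht', hq, h1, h2, h3⟩
  exact ⟨v, q, t, t', hv, ht, ht', hq, h1.congr fun e h _ => he e (mem_bondsIn.2 (hR _ h)),
    h2.congr fun e h _ => he e (mem_bondsIn.2 (hR _ h)),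
    h3.congr fun e h _ => he e (mem_bondsIn.2 h)⟩

open Classical in
lemma determinedBy_exitEvent (n m : ℤ) (F : Set (ℤ × ℤ)) :
    DeterminedBy ((bondsIn 0 m 0 (2 * n)).filter
      fun e => ¬(e.1 ∈ symRegion n F ∧ bondEnd e ∈ symRegion n F)) (exitEvent n m F) := by
  rintro ω ω' he ⟨v, w, q, hv, hvR, hw, hwR, hvw, hq, hc⟩
  refine ⟨v, w, q, hv, hvR, hw, hwR, hvw.congr ?_, hq, hc.congr ?_⟩
  · rintro e (⟨rfl, rfl⟩ | ⟨rfl, rfl⟩)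
    · exact he e (Finset.mem_filter.2 ⟨mem_bondsIn.2 hvR, fun h => hw h.2⟩)
    · exact he e (Finset.mem_filter.2 ⟨mem_bondsIn.2 hwR, fun h => hw h.1⟩)
  · intro e h _
    exact he e (Finset.mem_filter.2 ⟨mem_bondsIn.2 h.1, fun h' => h.2 h'.1⟩)

lemma fst_le_of_mem_cutRegion {n : ℤ} {F : Set (ℤ × ℤ)} (hF : ∀ f ∈ F, f.1 ≠ n + 1) {v : ℤ × ℤ}
    (hv : v ∈ cutRegion n F) : v.1 ≤ n := by
  obtain ⟨⟨x, y⟩, ⟨hR, hG⟩, hc, -⟩ := hv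
  have : x ≠ n + 1 := by
    intro hx
    exact hG ⟨(x, y), ⟨hR, fun h => hF _ h hx⟩, hx, .refl⟩
  rw [mem_rect] at hR
  simp only at hc
  omega

lemma mem_hookEvent_of_mem_exitEvent {n m : ℤ} (hn : 0 < n) {ω : PercCfg}
    (hω : dualCfg ω ∉ HCross 0 (n + 1) 0 (n - 1))
    (hE : ω ∈ exitEvent n m (leftCluster ω n n)) : ω ∈ hookEvent n m := by
  set F := leftCluster ω n n with hF
  obtain ⟨v, w, q, hv, hvR, hw, hwR, hvw, hq, hc⟩ := hE
  have hFr : ∀ f ∈ F, f.1 ≠ n + 1 := fun f hf h => hω (mem_HCross_dualCfg_iff.2 ⟨f, hf, h⟩)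
  have hvn := fst_le_of_mem_cutRegion hFr hv
  have hG : ∀ f ∈ rect 0 (n + 1) 0 (n - 1), IsCornerOf f w → f ∈ rightComponent n n F := by
    intro f hf hfw
    by_contra hG
    exact hw (Or.inl ⟨f, ⟨hf, hG⟩, hfw⟩)
  have hwc : (w.1, 2 * n - w.2) ∉ cutRegion n F := fun h => hw (Or.inr h)
  have hI : OnInterface n n (rightComponent n n F) v := by
    obtain ⟨⟨a, b⟩, ⟨hfR, hfG⟩, hfv⟩ := hv
    rw [mem_rect] at hfR
    have hcut : ∀ z, IsCornerOf (a, b) z → z ∈ cutRegion n F :=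
      fun z hz => ⟨(a, b), ⟨hfR, hfG⟩, hz⟩
    clear hc
    revert hfv hvR hwR hG hwc hvn
    have hw' : w ∉ cutRegion n F := fun h => hw (Or.inl h)
    revert hw'
    refine hvw.elim (P := fun v w => w ∉ cutRegion n F → v ∈ rect 0 m 0 (2 * n) →
      w ∈ rect 0 m 0 (2 * n) → v.1 ≤ n →
      (∀ f ∈ rect 0 (n + 1) 0 (n - 1), IsCornerOf f w → f ∈ rightComponent n n F) →
      (w.1, 2 * n - w.2) ∉ cutRegion n F → IsCornerOf (a, b) v →
      OnInterface n n (rightComponent n n F) v) ?_ ?_ ?_ ?_ <;>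
    intro x y _ hw hvR hwR hvn hG hwc hfv <;>
    simp only [mem_rect, IsCornerOf] at hvR hwR hfv hvn
    · have hax : a = x := by
        by_contra h
        exact hw (hcut _ (by simp only [IsCornerOf]; omega))
      refine Or.inl ⟨a, b, by rw [mem_rect]; omega, by rw [mem_rect]; omega, ?_, ?_⟩
      · have := hG (a + 1, b) (by rw [mem_rect]; omega) (by simp only [IsCornerOf]; omega)
        tauto
      · simp only [Prod.mk.injEq]; omega
    · have hax : a = x + 1 + 1 := by
        by_contra h
        exact hw (hcut _ (by simp only [IsCornerOf]; omega))
      rw [hax] at hfG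
      refine Or.inl ⟨x + 1, b, by rw [mem_rect]; omega, by rw [mem_rect]; omega, ?_, ?_⟩
      · have := hG (x + 1, b) (by rw [mem_rect]; omega) (by simp only [IsCornerOf]; omega)
        tauto
      · simp only [Prod.mk.injEq, true_and]; omega
    · have hby : b + 1 = y := by
        by_contra h
        exact hw (hcut _ (by simp only [IsCornerOf]; omega))
      have hbn : b + 1 < n := by
        by_contra h
        exact hwc (hcut _ (by simp only [IsCornerOf]; omega))
      refine Or.inr ⟨a, b + 1, by rw [mem_rect]; omega, by rw [mem_rect]; omega, ?_, ?_⟩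
      · have := hG (a, b + 1) (by rw [mem_rect]; omega) (by simp only [IsCornerOf]; omega)
        rw [add_sub_cancel_right]
        tauto
      · simp only [Prod.mk.injEq]; omega
    · have hby : b = y + 1 := by
        by_contra h
        exact hw (hcut _ (by simp only [IsCornerOf]; omega))
      rw [hby] at hfG
      refine Or.inr ⟨a, y + 1, by rw [mem_rect]; omega, by rw [mem_rect]; omega, ?_, ?_⟩
      · have := hG (a, y) (by rw [mem_rect]; omega) ⟨hfv.1, Or.inl rfl⟩
        rw [add_sub_cancel_right]
        tauto
      · simp only [Prod.mk.injEq, and_true]; omega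
  obtain ⟨t, t', ht, ht', hvn, h1, h2⟩ := hI.exists_conn hn.le hn hω
  exact ⟨v, q, t, t', hvn, ht, ht', hq, h1, h2,
    .head ⟨hvR, hwR, hvw⟩ (OpenConn.mono hc (fun _ => id) Set.sdiff_subset)⟩

lemma HCross_subset_exitEvent {n m : ℤ} (hn : 0 < n) (hm : n < m) {F : Set (ℤ × ℤ)}
    (hFl : ∀ y, 0 ≤ y → y < n → (0, y) ∈ F) (hFr : ∀ f ∈ F, f.1 ≠ n + 1) :
    HCross 0 m 0 (2 * n) ⊆
      exitEvent n m F ∪ {ω | (fun e => ω (reflectY (2 * n) e)) ∈ exitEvent n m F} := by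
  have hcut : ∀ y, 0 ≤ y → y ≤ n → (0, y) ∈ cutRegion n F := by
    intro y h0 hy
    have hF : ∀ y, 0 ≤ y → y < n → (0, y) ∈ rect 0 (n + 1) 0 (n - 1) \ rightComponent n n F :=
      fun y h0 hy => ⟨by rw [mem_rect]; omega,
        fun h => (rightComponent_subset _ _ _ h).2 (hFl _ h0 hy)⟩
    rcases hy.eq_or_lt with rfl | hy
    · exact ⟨_, hF (y - 1) (by omega) (by omega), by simp [IsCornerOf]⟩
    · exact ⟨_, hF y h0 hy, by simp [IsCornerOf]⟩
  have hR : ∀ z ∈ rect 0 m 0 (2 * n), (z.1, 2 * n - z.2) ∈ rect 0 m 0 (2 * n) := by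
    rintro ⟨x, y⟩ h
    simp only [mem_rect] at h ⊢
    omega
  have hJ : ∀ z, z ∉ symRegion n F → (z.1, 2 * n - z.2) ∉ symRegion n F := by
    rintro z hz (h | h)
    · exact hz (Or.inr h)
    · exact hz (Or.inl (by simpa using h))
  intro ω hω
  obtain ⟨p, q, hp, hp0, hqm, hpq⟩ := mem_HCross_iff.1 hω
  have hpJ : p ∈ symRegion n F := by
    obtain ⟨x, y⟩ := p
    rw [mem_rect] at hp
    obtain rfl : x = 0 := hp0
    rcases le_total y n with h | h
    · exact Or.inl (hcut _ (by omega) h)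
    · exact Or.inr (hcut _ (by omega) (by omega))
  have hqJ : q ∉ symRegion n F := by
    rintro (h | h) <;> have := fst_le_of_mem_cutRegion hFr h <;> omega
  obtain ⟨v, w, hv, hw, ⟨hvR, hwR, hvw⟩, hc⟩ := exists_last_exit hpq hpJ hqJ
  have hc' : OpenConn ω (rect 0 m 0 (2 * n) \ symRegion n F) w q :=
    hc.lift id fun _ _ h => ⟨⟨h.2.2.1, h.1⟩, ⟨h.2.2.2.1, h.2.1⟩, h.2.2.2.2⟩
  rcases hv with hv | hv
  · exact Or.inl ⟨v, w, q, hv, hvR, hw, hwR, hvw, hqm, hc'⟩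
  · have hJR : ∀ z ∈ rect 0 m 0 (2 * n) \ symRegion n F,
        (z.1, 2 * n - z.2) ∈ rect 0 m 0 (2 * n) \ symRegion n F :=
      fun z hz => ⟨hR z hz.1, hJ z hz.2⟩
    exact Or.inr ⟨_, _, (q.1, 2 * n - q.2), hv, hR _ hvR, hJ _ hw, hR _ hwR,
      hvw.reflectY (2 * n), hqm, OpenConn.map hc' (fun _ _ => BondOpen.reflectY (2 * n)) hJR⟩

lemma DeterminedBy.preimage {s : Finset GridBond} {E : Set PercCfg} (h : DeterminedBy s E)
    (σ : GridBond ≃ GridBond) :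
    DeterminedBy (s.map σ.toEmbedding) {ω | (fun e => ω (σ e)) ∈ E} := fun _ _ he =>
  h _ _ fun _ hes => he _ (Finset.mem_map_of_mem σ.toEmbedding hes)

lemma Increasing.preimage {E : Set PercCfg} (h : Increasing E) (σ : GridBond ≃ GridBond) :
    Increasing {ω | (fun e => ω (σ e)) ∈ E} := fun _ _ he => h _ _ fun _ => he _

lemma hookEvent_inter_subset {n m : ℤ} (hn : 0 < n) (hm : n < m) :
    hookEvent n m ∩ {ω | (fun e => ω (reflectX n e)) ∈ hookEvent n m} ∩ HCross 0 n 0 n ⊆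
      HCross (n - m) m 0 (2 * n) := by
  rintro ω ⟨⟨⟨v, q, t, t', hv, ht, ht', hq, h1, h2, h3⟩, hω⟩, hH⟩
  obtain ⟨v', q', s, s', hv', hs, hs', hq', h1', h2', h3'⟩ := hω
  obtain ⟨a, b, ha, ha0, hbn, hab⟩ := mem_HCross_iff.1 hH
  have hback : ∀ u z, BondOpen (fun e => ω (reflectX n e)) u z →
      BondOpen ω (n - u.1, u.2) (n - z.1, z.2) := by
    intro u z h
    simpa using h.reflectX n
  have hsq : ∀ z ∈ rect 0 n 0 n, (n - z.1, z.2) ∈ rect 0 n 0 n := by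
    rintro ⟨x, y⟩ h
    simp only [mem_rect] at h ⊢
    omega
  have hbig : ∀ z ∈ rect 0 m 0 (2 * n), (n - z.1, z.2) ∈ rect (n - m) m 0 (2 * n) := by
    rintro ⟨x, y⟩ h
    simp only [mem_rect] at h ⊢
    omega
  have hsub : rect 0 n 0 n ⊆ rect (n - m) m 0 (2 * n) := by
    rintro ⟨x, y⟩ h
    rw [mem_rect] at h ⊢
    omega
  have hwide : rect 0 m 0 (2 * n) ⊆ rect (n - m) m 0 (2 * n) := by
    rintro ⟨x, y⟩ h
    rw [mem_rect] at h ⊢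
    omega
  have h1' := h1'.map hback hsq
  have h2' := h2'.map hback hsq
  have h3' := h3'.map hback hbig
  have hva : OpenConn ω (rect 0 n 0 n) v a :=
    h1.trans (OpenConn.meet hn.le ha (OpenConn.mem h1 hv) ha0 hbn ht ht' hab (h1.symm.trans h2))
  have hva' : OpenConn ω (rect 0 n 0 n) (n - v'.1, v'.2) a :=
    h1'.trans (OpenConn.meet hn.le ha (OpenConn.mem h1' (hsq _ hv')) ha0 hbn hs
      (v := (n - s'.1, s'.2)) hs' hab (h1'.symm.trans h2'))
  have hvv : OpenConn ω (rect (n - m) m 0 (2 * n)) (n - v'.1, v'.2) v :=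
    OpenConn.mono (hva'.trans hva.symm) (fun _ => id) hsub
  exact mem_HCross_iff.2 ⟨(n - q'.1, q'.2), q, OpenConn.mem h3' (hsub (hsq _ hv')), by simp [hq'],
    hq, h3'.symm.trans (hvv.trans (h3.mono (fun _ => id) hwide))⟩

/-- Lower bounds for the probability of crossing `[0,(2^k+1)n] × [0,2n]` horizontally. -/
noncomputable def crossingBound : ℕ → ℝ
  | 0 => 1 / 2
  | k + 1 => (crossingBound k / 4) ^ 2 / 2

lemma crossingBound_pos (k : ℕ) : 0 < crossingBound k := by
  induction k with
  | zero => norm_num [crossingBound]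
  | succ k ih => rw [crossingBound]; positivity

lemma IsBondPerc.real_HCross_le_exitEvent {Pr : Measure PercCfg} (hPr : IsBondPerc Pr)
    {n m : ℤ} (hn : 0 < n) (hm : n < m)
    {F : Set (ℤ × ℤ)} (hFl : ∀ y, 0 ≤ y → y < n → (0, y) ∈ F) (hFr : ∀ f ∈ F, f.1 ≠ n + 1) :
    Pr.real (HCross 0 m 0 (2 * n)) / 2 ≤ Pr.real (exitEvent n m F) := by
  have := hPr.1
  have h := (measureReal_mono (μ := Pr) (HCross_subset_exitEvent hn hm hFl hFr)).trans
    (measureReal_union_le _ _)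
  rw [hPr.real_preimage_symm _ (determinedBy_exitEvent n m F)] at h
  linarith

open Classical in
lemma IsBondPerc.real_leftCluster_eq_inter_exitEvent {Pr : Measure PercCfg} (hPr : IsBondPerc Pr)
    (n m : ℤ) {F : Finset (ℤ × ℤ)}
    (hF : (F : Set (ℤ × ℤ)) ⊆ rect 0 (n + 1) 0 (n - 1)) :
    Pr.real ({ω | leftCluster ω n n = F} ∩ exitEvent n m F) =
      Pr.real {ω | leftCluster ω n n = F} * Pr.real (exitEvent n m F) := by
  refine hPr.real_inter_eq_mul (determinedBy_leftCluster_eq n n F) (determinedBy_exitEvent n m F) ?_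
  rw [Finset.disjoint_left]
  intro e he he'
  obtain ⟨f, hf, hef⟩ := Finset.mem_biUnion.1 he
  have hfc : f ∈ rect 0 (n + 1) 0 (n - 1) \ rightComponent n n F :=
    ⟨hF hf, fun h => (rightComponent_subset _ _ _ h).2 hf⟩
  obtain ⟨h1, h2⟩ := isCorner_of_mem_squareBonds hef
  exact (Finset.mem_filter.1 he').2 ⟨Or.inl ⟨f, hfc, h1⟩, Or.inl ⟨f, hfc, h2⟩⟩

lemma IsBondPerc.real_HCross_le_hookEvent {Pr : Measure PercCfg} (hPr : IsBondPerc Pr)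
    {n m : ℤ} (hn : 0 < n) (hm : n < m) :
    Pr.real (HCross 0 m 0 (2 * n)) / 4 ≤ Pr.real (hookEvent n m) := by
  classical
  have := hPr.1
  set squares : Finset (ℤ × ℤ) := Finset.Icc 0 (n + 1) ×ˢ Finset.Icc 0 (n - 1) with hsq
  have hsquares : (squares : Set (ℤ × ℤ)) = rect 0 (n + 1) 0 (n - 1) := by
    ext ⟨x, y⟩
    simp only [hsq, Finset.coe_product, Finset.coe_Icc, Set.mem_prod, Set.mem_Icc, mem_rect]
    tauto
  set good : Finset (Finset (ℤ × ℤ)) := squares.powerset.filter fun F =>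
    ∃ ω, leftCluster ω n n = F ∧ dualCfg ω ∉ HCross 0 (n + 1) 0 (n - 1) with hgood
  set T : Finset (ℤ × ℤ) → Set PercCfg := fun F => {ω | leftCluster ω n n = F} with hT
  have hgoodF : ∀ F ∈ good, (F : Set (ℤ × ℤ)) ⊆ rect 0 (n + 1) 0 (n - 1) ∧
      (∀ y, 0 ≤ y → y < n → (0, y) ∈ F) ∧ ∀ f ∈ F, f.1 ≠ n + 1 := by
    intro F hF
    obtain ⟨hFs, ω, hω, hdual⟩ := Finset.mem_filter.1 hF
    simp only [← Finset.mem_coe, ← hω]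
    refine ⟨leftCluster_subset _ _ _, fun y h0 hy => ⟨(0, y), ?_, rfl, .refl⟩, fun f hf h => ?_⟩
    · rw [mem_rect]; omega
    · exact hdual (mem_HCross_dualCfg_iff.2 ⟨f, hf, h⟩)
  have hcover : {ω | dualCfg ω ∉ HCross 0 (n + 1) 0 (n - 1)} ⊆ ⋃ F ∈ good, T F := by
    intro ω hω
    have hfin : (leftCluster ω n n).Finite :=
      squares.finite_toSet.subset (hsquares ▸ leftCluster_subset _ _ _)
    refine Set.mem_biUnion (x := hfin.toFinset) ?_ (by simp [hT])
    rw [Finset.mem_coe, Finset.mem_filter, Finset.mem_powerset]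
    refine ⟨?_, ω, by simp, hω⟩
    rw [← Finset.coe_subset, hsquares, Set.Finite.coe_toFinset]
    exact leftCluster_subset _ _ _
  have hdisj : Set.PairwiseDisjoint (good : Set (Finset (ℤ × ℤ)))
      fun F => T F ∩ exitEvent n m F := by
    intro F _ F' _ hFF
    rw [Function.onFun, Set.disjoint_left]
    rintro ω ⟨h, -⟩ ⟨h', -⟩
    exact hFF (Finset.coe_injective (Eq.trans (Eq.symm h) h'))
  have hsub : ⋃ F ∈ good, T F ∩ exitEvent n m F ⊆ hookEvent n m := by
    intro ω hω
    obtain ⟨F, hF, hTω, hEω⟩ := Set.mem_iUnion₂.1 hω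
    have hTω : leftCluster ω n n = F := hTω
    refine mem_hookEvent_of_mem_exitEvent hn (fun h => ?_) (hTω ▸ hEω)
    obtain ⟨f, hf, hfn⟩ := mem_HCross_dualCfg_iff.1 h
    exact (hgoodF F hF).2.2 f (by rwa [← Finset.mem_coe, ← hTω]) hfn
  have hmeas : ∀ F ∈ good, MeasurableSet (T F ∩ exitEvent n m F) := fun F _ =>
    (determinedBy_leftCluster_eq n n F).measurableSet.inter
      (determinedBy_exitEvent n m F).measurableSet
  calc Pr.real (HCross 0 m 0 (2 * n)) / 4
      = 1 / 2 * (Pr.real (HCross 0 m 0 (2 * n)) / 2) := by ring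
    _ ≤ (∑ F ∈ good, Pr.real (T F)) * (Pr.real (HCross 0 m 0 (2 * n)) / 2) := by
        gcongr
        exact (hPr.half_le_not_HCross_dualCfg hn).trans
          ((measureReal_mono hcover (measure_ne_top _ _)).trans (measureReal_biUnion_finset_le _ _))
    _ ≤ ∑ F ∈ good, Pr.real (T F ∩ exitEvent n m F) := by
        rw [Finset.sum_mul]
        refine Finset.sum_le_sum fun F hF => ?_
        obtain ⟨h1, h2, h3⟩ := hgoodF F hF
        rw [hPr.real_leftCluster_eq_inter_exitEvent n m h1]
        gcongr
        exact hPr.real_HCross_le_exitEvent hn hm h2 h3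
    _ = Pr.real (⋃ F ∈ good, T F ∩ exitEvent n m F) :=
        (measureReal_biUnion_finset hdisj hmeas).symm
    _ ≤ Pr.real (hookEvent n m) := measureReal_mono hsub

lemma IsBondPerc.real_HCross_extend {Pr : Measure PercCfg} (hPr : IsBondPerc Pr)
    {n m : ℤ} (hn : 0 < n) (hm : n < m) :
    (Pr.real (HCross 0 m 0 (2 * n)) / 4) ^ 2 / 2 ≤
      Pr.real (HCross 0 (2 * m - n) 0 (2 * n)) := by
  classical
  have := hPr.1
  set H' : Set PercCfg := {ω | (fun e => ω (reflectX n e)) ∈ hookEvent n m} with hH'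
  set s := bondsIn 0 m 0 (2 * n) with hs
  set s' := s.map (reflectX n).toEmbedding with hs'
  have d := determinedBy_hookEvent hm
  have d1 : DeterminedBy (s ∪ s' ∪ bondsIn 0 n 0 n) (hookEvent n m) :=
    d.mono (Finset.subset_union_left.trans Finset.subset_union_left)
  have d2 : DeterminedBy (s ∪ s' ∪ bondsIn 0 n 0 n) H' :=
    (d.preimage (reflectX n)).mono (Finset.subset_union_right.trans Finset.subset_union_left)
  have d3 : DeterminedBy (s ∪ s' ∪ bondsIn 0 n 0 n) (HCross 0 n 0 n) :=
    (determinedBy_HCross 0 n 0 n).mono Finset.subset_union_right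
  have i1 := increasing_hookEvent n m
  have i2 : Increasing H' := i1.preimage (reflectX n)
  have e2 : Pr.real H' = Pr.real (hookEvent n m) := hPr.real_preimage_symm _ d
  have hook := hPr.real_HCross_le_hookEvent hn hm
  have hsquare := hPr.half_le_HCross_square hn
  calc (Pr.real (HCross 0 m 0 (2 * n)) / 4) ^ 2 / 2
      = (Pr.real (HCross 0 m 0 (2 * n)) / 4) * (Pr.real (HCross 0 m 0 (2 * n)) / 4) * (1 / 2) := by
        ring
    _ ≤ Pr.real (hookEvent n m) * Pr.real H' * Pr.real (HCross 0 n 0 n) := by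
        rw [e2]
        gcongr
    _ ≤ Pr.real (hookEvent n m ∩ H') * Pr.real (HCross 0 n 0 n) := by
        gcongr
        exact hPr.mul_le_real_inter d1 d2 i1 i2
    _ ≤ Pr.real (hookEvent n m ∩ H' ∩ HCross 0 n 0 n) :=
        hPr.mul_le_real_inter (d1.inter d2) d3 (i1.inter i2) (increasing_HCross 0 n 0 n)
    _ ≤ Pr.real (HCross (n - m) m 0 (2 * n)) := measureReal_mono (hookEvent_inter_subset hn hm)
    _ ≤ Pr.real (HCross (m - m) (m - (n - m)) 0 (2 * n)) := hPr.real_HCross_reflect _ _ _ _ _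
    _ = Pr.real (HCross 0 (2 * m - n) 0 (2 * n)) := by
        congr 2 <;> ring

lemma IsBondPerc.crossingBound_le {Pr : Measure PercCfg} (hPr : IsBondPerc Pr)
    {n : ℤ} (hn : 0 < n) (k : ℕ) :
    crossingBound k ≤ Pr.real (HCross 0 ((2 ^ k + 1) * n) 0 (2 * n)) := by
  induction k with
  | zero =>
    have h := hPr.half_le_HCross_square (n := 2 * n) (by omega)
    simpa [crossingBound, one_add_one_eq_two] using h
  | succ k ih =>
    have hm : n < (2 ^ k + 1) * n := by
      have : (0 : ℤ) < 2 ^ k := by positivity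
      nlinarith
    have hpos := crossingBound_pos k
    calc crossingBound (k + 1) = (crossingBound k / 4) ^ 2 / 2 := rfl
      _ ≤ (Pr.real (HCross 0 ((2 ^ k + 1) * n) 0 (2 * n)) / 4) ^ 2 / 2 := by gcongr
      _ ≤ Pr.real (HCross 0 (2 * ((2 ^ k + 1) * n) - n) 0 (2 * n)) :=
          hPr.real_HCross_extend hn hm
      _ = Pr.real (HCross 0 ((2 ^ (k + 1) + 1) * n) 0 (2 * n)) := by
          congr 2; ring

/-- A vertical crossing of a rectangle of fixed size along the left side. -/
lemma IsBondPerc.half_pow_le_VCross {Pr : Measure PercCfg} (hPr : IsBondPerc Pr)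
    (k : ℕ) {b : ℤ} (hb : 0 ≤ b) :
    (1 / 2) ^ k ≤ Pr.real (VCross 0 b 0 k) := by
  have := hPr.1
  set s : Finset GridBond := (Finset.range k).image fun i : ℕ => ((0, (i : ℤ)), false) with hs
  have hcard : s.card = k := by
    rw [hs, Finset.card_image_of_injective _ fun i j h => by simpa using h, Finset.card_range]
  have hP := hPr.2 s fun _ => true
  have hP' : Pr.real {ω | ∀ e ∈ s, ω e = true} = (1 / 2) ^ k := by
    rw [measureReal_def, hP, hcard]
    simp
  rw [← hP']
  refine measureReal_mono fun ω hω => ?_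
  refine ⟨k, fun i => (0, (i : ℤ)), ⟨fun i hi => ?_, fun i hi => ?_⟩, rfl, rfl⟩
  · show ((0 : ℤ), (i : ℤ)) ∈ rect 0 b 0 k
    rw [mem_rect]
    omega
  · simpa using bondOpen_up (hω ((0, (i : ℤ)), false)
      (Finset.mem_image.2 ⟨i, Finset.mem_range.2 hi, rfl⟩))

/-- **Russo–Seymour–Welsh theorem for critical bond percolation on `ℤ²`**
(Theorem 5.3): there is `c > 0` such that for every `n ≥ 1` the rectangle
`[0,n] × [0,100n]` has an open vertical crossing with probability at least `c`. -/
theorem RSW_Z2 :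
    ∃ c : ENNReal, 0 < c ∧
      ∀ Pr : Measure PercCfg, IsBondPerc Pr →
        ∀ (n : ℕ), 1 ≤ n →
          c ≤ Pr (VCross 0 (n : ℤ) 0 (100 * (n : ℤ))) := by
  refine ⟨ENNReal.ofReal (min (crossingBound 9) ((1 / 2) ^ 100)), ?_, fun Pr hPr n hn => ?_⟩
  · have := crossingBound_pos 9
    rw [ENNReal.ofReal_pos]
    positivity
  have := hPr.1
  rw [ENNReal.ofReal_le_iff_le_toReal (measure_ne_top _ _), ← measureReal_def]
  rcases hn.eq_or_lt with rfl | hn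
  · simpa using (min_le_right _ _).trans (hPr.half_pow_le_VCross 100 (b := 1) zero_le_one)
  · have h := hPr.crossingBound_le (n := (n / 2 : ℕ)) (by omega) 9
    rw [← hPr.real_VCross] at h
    refine (min_le_left _ _).trans (h.trans (measureReal_mono (VCross_subset_of_le ?_ ?_ ?_)))
    all_goals push_cast; omega
end

section
/- Horizontal and vertical crossings of a rectangle must meet: Let a ≤ b and c ≤ d be integers and let R be the set of (x,y) ∈ ℤ² with a ≤ x ≤ b and c ≤ y ≤ d. Let v_0, …, v_k be a lattice path in R whose first vertex has x-coordinate a and whose last vertex has x-coordinate b, and let w_0, …, w_l be a lattice path in R whose first vertex has y-coordinate c and whose last vertex has y-coordinate d. Then the two paths share a vertex: v_i = w_j for some indices i and j. -/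
/-- `u` and `v` are adjacent in the grid `ℤ²`, i.e. at `ℓ¹`-distance `1`. -/
def Adj (u v : ℤ × ℤ) : Prop := |u.1 - v.1| + |u.2 - v.2| = 1

theorem Adj.cases {u v : ℤ × ℤ} (h : Adj u v) :
    (v.1 = u.1 + 1 ∧ v.2 = u.2) ∨ (u.1 = v.1 + 1 ∧ v.2 = u.2) ∨
      (v.1 = u.1 ∧ v.2 = u.2 + 1) ∨ (v.1 = u.1 ∧ u.2 = v.2 + 1) := by
  unfold Adj at h
  rcases abs_cases (u.1 - v.1) with h1 | h1 <;> rcases abs_cases (u.2 - v.2) with h2 | h2 <;> omega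

/-- The signed number of times the first `n` steps of `v` cross, from left to right, the downward
vertical ray issuing from a point just to the right of `p`. -/
def rayCrossings (v : ℕ → ℤ × ℤ) (n : ℕ) (p : ℤ × ℤ) : ℤ :=
  ∑ i ∈ Finset.range n,
    ((if p.1 < (v (i + 1)).1 then 1 else 0) - (if p.1 < (v i).1 then 1 else 0)) *
      (if (v i).2 < p.2 then 1 else 0)

theorem rayCrossings_eq_of_up {v : ℕ → ℤ × ℤ} {n : ℕ} (hv : ∀ i < n, Adj (v i) (v (i + 1)))
    {p q : ℤ × ℤ} (hp : ∀ i ≤ n, v i ≠ p) (h1 : q.1 = p.1) (h2 : q.2 = p.2 + 1) :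
    rayCrossings v n p = rayCrossings v n q := by
  refine Finset.sum_congr rfl fun i hi => ?_
  have hi := Finset.mem_range.1 hi
  have ha := (hv i hi).cases
  have hpi := hp i hi.le
  have hpi' := hp (i + 1) hi
  simp only [ne_eq, Prod.ext_iff] at hpi hpi'
  split_ifs <;> omega

theorem rayCrossings_eq_of_right {v : ℕ → ℤ × ℤ} {n : ℕ} (hv : ∀ i < n, Adj (v i) (v (i + 1)))
    {p q : ℤ × ℤ} (hq : ∀ i ≤ n, v i ≠ q) (h1 : q.1 = p.1 + 1) (h2 : q.2 = p.2)
    (h0 : (v 0).1 < q.1) (hn : q.1 < (v n).1) :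
    rayCrossings v n p = rayCrossings v n q := by
  have tele := Finset.sum_range_sub
    (fun i => if (v i).1 = q.1 ∧ (v i).2 < q.2 then (1 : ℤ) else 0) n
  rw [if_neg (by omega), if_neg (by omega), sub_zero] at tele
  rw [← sub_eq_zero, ← tele, rayCrossings, rayCrossings, ← Finset.sum_sub_distrib]
  refine Finset.sum_congr rfl fun i hi => ?_
  have hi := Finset.mem_range.1 hi
  have ha := (hv i hi).cases
  have hqi := hq i hi.le
  have hqi' := hq (i + 1) hi
  simp only [ne_eq, Prod.ext_iff] at hqi hqi'
  split_ifs <;> omega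

theorem rayCrossings_eq_of_adj {v : ℕ → ℤ × ℤ} {n : ℕ} (hv : ∀ i < n, Adj (v i) (v (i + 1)))
    {p q : ℤ × ℤ} (hp : ∀ i ≤ n, v i ≠ p) (hq : ∀ i ≤ n, v i ≠ q) (hpq : Adj p q)
    (hp0 : (v 0).1 ≤ p.1) (hpn : p.1 < (v n).1) (hq0 : (v 0).1 ≤ q.1) (hqn : q.1 < (v n).1) :
    rayCrossings v n p = rayCrossings v n q := by
  rcases hpq.cases with h | h | h | h
  · exact rayCrossings_eq_of_right hv hq h.1 h.2 (by omega) hqn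
  · exact (rayCrossings_eq_of_right hv hp h.1 h.2.symm (by omega) hpn).symm
  · exact rayCrossings_eq_of_up hv hp h.1 h.2
  · exact (rayCrossings_eq_of_up hv hq h.1.symm h.2).symm

theorem rayCrossings_eq_zero {v : ℕ → ℤ × ℤ} {n : ℕ} {p : ℤ × ℤ}
    (h : ∀ i ≤ n, p.2 ≤ (v i).2) : rayCrossings v n p = 0 := by
  refine Finset.sum_eq_zero fun i hi => ?_
  rw [if_neg (not_lt.2 (h i (Finset.mem_range.1 hi).le)), mul_zero]

theorem rayCrossings_eq_one {v : ℕ → ℤ × ℤ} {n : ℕ} (hv : ∀ i < n, Adj (v i) (v (i + 1)))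
    {p : ℤ × ℤ} (hp : ∀ i ≤ n, v i ≠ p) (h : ∀ i ≤ n, (v i).2 ≤ p.2)
    (h0 : (v 0).1 ≤ p.1) (hn : p.1 < (v n).1) : rayCrossings v n p = 1 := by
  have tele := Finset.sum_range_sub (fun i => if p.1 < (v i).1 then (1 : ℤ) else 0) n
  rw [if_pos hn, if_neg (by omega), sub_zero] at tele
  rw [← tele, rayCrossings]
  refine Finset.sum_congr rfl fun i hi => ?_
  have hi := Finset.mem_range.1 hi
  have ha := (hv i hi).cases
  have hpi := hp i hi.le
  have hpi' := hp (i + 1) hi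
  have hle := h i hi.le
  simp only [ne_eq, Prod.ext_iff] at hpi hpi'
  split_ifs <;> omega

/-- A path from the left side of a strip to beyond its right side meets every path within the strip
which starts below it and ends above it. -/
theorem exists_eq_of_crossing_strip {k l : ℕ} {v w : ℕ → ℤ × ℤ}
    (hvA : ∀ i < k, Adj (v i) (v (i + 1))) (hwA : ∀ j < l, Adj (w j) (w (j + 1)))
    (hleft : ∀ j ≤ l, (v 0).1 ≤ (w j).1) (hright : ∀ j ≤ l, (w j).1 < (v k).1)
    (hbot : ∀ i ≤ k, (w 0).2 ≤ (v i).2) (htop : ∀ i ≤ k, (v i).2 ≤ (w l).2) :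
    ∃ i ≤ k, ∃ j ≤ l, v i = w j := by
  by_contra! hne
  have key : ∀ j ≤ l, rayCrossings v k (w j) = 0 := by
    intro j
    induction j with
    | zero => exact fun _ => rayCrossings_eq_zero hbot
    | succ j ih =>
      intro hj
      rw [← ih (by omega)]
      exact (rayCrossings_eq_of_adj hvA (fun i hi => hne i hi j (by omega))
        (fun i hi => hne i hi (j + 1) hj) (hwA j hj) (hleft j (by omega)) (hright j (by omega))
        (hleft _ hj) (hright _ hj)).symm
  have hone := rayCrossings_eq_one hvA (fun i hi => hne i hi l le_rfl) htop (hleft l le_rfl)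
    (hright l le_rfl)
  rw [key l le_rfl] at hone
  exact zero_ne_one hone

/-- **Horizontal and vertical crossings of a rectangle must meet**: a lattice
path in `R = [a,b]×[c,d]` from the left side to the right side and a lattice
path in `R` from the bottom side to the top side share a vertex. -/
theorem crossings_must_meet (a b c d : ℤ) (hab : a ≤ b) (hcd : c ≤ d)
    (k l : ℕ) (v w : ℕ → ℤ × ℤ)
    (hvR : ∀ i ≤ k, InRect a b c d (v i))
    (hvA : ∀ i < k, Adj (v i) (v (i + 1)))
    (hv0 : (v 0).1 = a) (hvk : (v k).1 = b)
    (hwR : ∀ j ≤ l, InRect a b c d (w j))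
    (hwA : ∀ j < l, Adj (w j) (w (j + 1)))
    (hw0 : (w 0).2 = c) (hwl : (w l).2 = d) :
    ∃ i ≤ k, ∃ j ≤ l, v i = w j := by
  let v' : ℕ → ℤ × ℤ := fun i => if i ≤ k then v i else (b + 1, (v k).2)
  have hv' : ∀ i ≤ k, v' i = v i := fun i hi => if_pos hi
  have hlast : v' (k + 1) = (b + 1, (v k).2) := if_neg (by omega)
  have hy : ∀ i ≤ k + 1, c ≤ (v' i).2 ∧ (v' i).2 ≤ d := by
    intro i hi
    rcases Nat.le_succ_iff.1 hi with hi | rfl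
    · rw [hv' i hi]
      exact (hvR i hi).2.2
    · rw [hlast]
      exact (hvR k le_rfl).2.2
  obtain ⟨i, hi, j, hj, hij⟩ : ∃ i ≤ k + 1, ∃ j ≤ l, v' i = w j := by
    refine exists_eq_of_crossing_strip ?_ hwA (fun j hj => ?_) (fun j hj => ?_)
      (fun i hi => hw0 ▸ (hy i hi).1) (fun i hi => hwl ▸ (hy i hi).2)
    · intro i hi
      rcases Nat.lt_succ_iff_lt_or_eq.1 hi with hi | rfl
      · rw [hv' i hi.le, hv' (i + 1) hi]
        exact hvA i hi
      · rw [hv' i le_rfl, hlast]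
        simp [Adj, hvk]
    · rw [hv' 0 (Nat.zero_le k), hv0]
      exact (hwR j hj).1
    · rw [hlast]
      exact Int.lt_add_one_of_le (hwR j hj).2.1
  rcases Nat.le_succ_iff.1 hi with hi | rfl
  · exact ⟨i, hi, j, hj, hv' i hi ▸ hij⟩
  · have hb := (hwR j hj).2.1
    rw [← hij, hlast] at hb
    exact absurd hb (by simp)
end
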